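/- arXiv:2007.09821 — 3 statements merged into one kernel-verified Lean document; each statement's English description precedes it below -/
import Mathlib

section
/- For all integers m ≥ 0, the Hankel determinants of the sequence (k·E_{k−1})_{k≥0} of Euler numbers (with first term 0) satisfy H_{2m}(k E_{k−1}) = 0 and H_{2m+1}(k E_{k−1}) = (−1)^{m+1} · 2^{4m(m+1)} · Π_{ℓ=1}^{m} (ℓ!)^8. -/
/-- The `n`-th Hankel determinant of a sequence `c`. -/
noncomputable def hankel {R : Type*} [CommRing R] (c : ℕ → R) (n : ℕ) : R :=
  (Matrix.of fun i j : Fin (n + 1) => c (i.1 + j.1)).det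

/-- The `n`-th Euler polynomial, evaluated at `x`, via
`E_n(x) = (2/(n+1)) (B_{n+1}(x) - 2^{n+1} B_{n+1}(x/2))`. -/
noncomputable def eulerPoly (n : ℕ) (x : ℚ) : ℚ :=
  (2 / (n + 1)) *
    ((Polynomial.bernoulli (n + 1)).eval x - 2 ^ (n + 1) * (Polynomial.bernoulli (n + 1)).eval (x / 2))

/-- The `n`-th Euler number `E_n = 2^n E_n(1/2)`. -/
noncomputable def eulerNum (n : ℕ) : ℚ := 2 ^ n * eulerPoly n (1 / 2)

open Finset Polynomial

section Moments

variable {R : Type*} [CommRing R]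

/-- The linear functional on polynomials whose moments are the sequence `c`. -/
noncomputable def momentFunctional (c : ℕ → R) : R[X] →ₗ[R] R :=
  Polynomial.lsum fun n => LinearMap.toSpanSingleton R R (c n)

theorem momentFunctional_X_pow (c : ℕ → R) (n : ℕ) : momentFunctional c (X ^ n) = c n := by
  rw [← monomial_one_right_eq_X_pow]
  simp [momentFunctional, Polynomial.lsum_apply]

theorem momentFunctional_C_mul (c : ℕ → R) (a : R) (p : R[X]) :
    momentFunctional c (C a * p) = a * momentFunctional c p := by
  rw [← smul_eq_C_mul, map_smul, smul_eq_mul]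

theorem momentFunctional_mul (c : ℕ → R) {N : ℕ} {p q : R[X]} (hp : p.natDegree < N)
    (hq : q.natDegree < N) :
    momentFunctional c (p * q) =
      ∑ b : Fin N, (∑ a : Fin N, p.coeff a * c (a.1 + b.1)) * q.coeff b := by
  conv_lhs => rw [p.as_sum_range_C_mul_X_pow' hp, q.as_sum_range_C_mul_X_pow' hq]
  rw [← Fin.sum_univ_eq_sum_range (fun i => C (p.coeff i) * X ^ i),
    ← Fin.sum_univ_eq_sum_range (fun i => C (q.coeff i) * X ^ i), Finset.sum_mul_sum,
    Finset.sum_comm, map_sum]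
  refine Finset.sum_congr rfl fun b _ => ?_
  rw [map_sum, Finset.sum_mul]
  refine Finset.sum_congr rfl fun a _ => ?_
  have h : C (p.coeff a) * X ^ (a : ℕ) * (C (q.coeff b) * X ^ (b : ℕ)) =
      C (p.coeff a * q.coeff b) * X ^ (a.1 + b.1) := by
    rw [C_mul, pow_add]; ring
  rw [h, momentFunctional_C_mul, momentFunctional_X_pow]
  ring

/-- A Hankel determinant is the Gram determinant of any monic basis with degrees `0, 1, 2, …`. -/
theorem hankel_eq_det_momentFunctional (c : ℕ → R) (p : ℕ → R[X])
    (hdeg : ∀ i, (p i).natDegree = i) (hmonic : ∀ i, (p i).Monic) (n : ℕ) :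
    hankel c n =
      (Matrix.of fun i j : Fin (n + 1) => momentFunctional c (p i * p j)).det := by
  set P : Matrix (Fin (n + 1)) (Fin (n + 1)) R := Matrix.of fun i j => (p j).coeff i
  have hP : P.det = 1 :=
    Matrix.det_matrixOfPolynomials (fun i : Fin (n + 1) => p i) (fun i => hdeg i)
      (fun i => hmonic i)
  have hG : (Matrix.of fun i j : Fin (n + 1) => momentFunctional c (p i * p j)) =
      P.transpose * (Matrix.of fun i j : Fin (n + 1) => c (i.1 + j.1)) * P := by
    ext i j
    rw [Matrix.of_apply, momentFunctional_mul c (N := n + 1) (by rw [hdeg]; exact i.2)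
      (by rw [hdeg]; exact j.2)]
    simp [Matrix.mul_apply, P]
  rw [hG, Matrix.det_mul, Matrix.det_mul, Matrix.det_transpose, hP, hankel]
  ring

/-- Sequences vanishing at even indices have vanishing Hankel determinants of odd order. -/
theorem hankel_even_eq_zero {c : ℕ → ℚ} (hc : ∀ k, c (2 * k) = 0) (m : ℕ) :
    hankel c (2 * m) = 0 := by
  set M : Matrix (Fin (2 * m + 1)) (Fin (2 * m + 1)) ℚ := Matrix.of fun i j => c (i.1 + j.1)
  have hM : (Matrix.of fun i j : Fin (2 * m + 1) => (-1 : ℚ) ^ (i : ℕ) *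
      (Matrix.of fun i j : Fin (2 * m + 1) => (-1 : ℚ) ^ (j : ℕ) * M i j) i j) = -M := by
    ext i j
    simp only [Matrix.of_apply, Matrix.neg_apply, M]
    rw [← mul_assoc, ← pow_add]
    rcases Nat.even_or_odd (i.1 + j.1) with h | h
    · obtain ⟨k, hk⟩ := h
      rw [hk, ← two_mul, hc]; simp
    · rw [h.neg_one_pow]; ring
  have h := congrArg Matrix.det hM
  rw [Matrix.det_mul_column, Matrix.det_mul_row, Matrix.det_neg, ← mul_assoc,
    ← Finset.prod_mul_distrib] at h
  have h1 : ∀ i : Fin (2 * m + 1), (-1 : ℚ) ^ (i : ℕ) * (-1) ^ (i : ℕ) = 1 := fun i => by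
    rw [← mul_pow]; simp
  simp only [h1, Finset.prod_const_one, Fintype.card_fin, one_mul,
    (odd_two_mul_add_one m).neg_one_pow] at h
  change M.det = 0
  linarith

theorem det_fromBlocks_zero_self {n : ℕ} (A : Matrix (Fin n) (Fin n) R) :
    (Matrix.fromBlocks 0 A A 0).det = (-1) ^ n * A.det ^ 2 := by
  have h : (Matrix.fromBlocks 0 A A 0) =
      Matrix.fromBlocks 1 (-1) 0 1 * (Matrix.fromBlocks 1 1 1 0 *
        Matrix.fromBlocks A 0 0 A) := by
    simp [Matrix.fromBlocks_multiply]
  rw [h, Matrix.det_mul, Matrix.det_mul, Matrix.det_fromBlocks_zero₂₁,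
    Matrix.det_fromBlocks_zero₂₁, Matrix.det_fromBlocks_one₁₁]
  simp [Matrix.det_neg]
  ring

/-- Hankel determinants of even order of a sequence vanishing at even indices. -/
theorem hankel_odd_eq {c : ℕ → R} (hc : ∀ k, c (2 * k) = 0) (m : ℕ) :
    hankel c (2 * m + 1) = (-1) ^ (m + 1) * hankel (fun k => c (2 * k + 1)) m ^ 2 := by
  let f : Fin (m + 1) ⊕ Fin (m + 1) → Fin (2 * m + 1 + 1) :=
    Sum.elim (fun i => ⟨2 * i, by omega⟩) (fun i => ⟨2 * i + 1, by omega⟩)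
  have hf : Function.Bijective f := by
    rw [Fintype.bijective_iff_injective_and_card]
    refine ⟨?_, by simp; ring⟩
    rintro (i | i) (j | j) h <;> simp [f, Fin.ext_iff] at h ⊢ <;> omega
  rw [hankel, ← Matrix.det_submatrix_equiv_self (Equiv.ofBijective f hf), hankel,
    ← det_fromBlocks_zero_self]
  congr 1
  ext (i | i) (j | j) <;> simp [f]
  · rw [← mul_add, hc]
  · congr 1; ring
  · congr 1; ring
  · rw [show 2 * i.1 + 1 + (2 * j.1 + 1) = 2 * (i + j + 1) by ring, hc]

end Moments

theorem det_choose_add (n : ℕ) (u : ℕ → ℚ) :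
    (Matrix.of fun i j : Fin n => u i * u j * ((i.1 + j.1).choose i : ℚ)).det =
      ∏ i ∈ range n, u i ^ 2 := by
  set P : Matrix (Fin n) (Fin n) ℚ := Matrix.of fun i k => u i * ((i : ℕ).choose k : ℚ)
  have hP : P.det = ∏ i ∈ range n, u i := by
    rw [Matrix.det_of_isLowerTriangular]
    · simp [P, Finset.prod_range]
    · intro i j hij
      have : (i : ℕ) < j := hij
      simp [P, Nat.choose_eq_zero_of_lt this]
  have h : (Matrix.of fun i j : Fin n => u i * u j * ((i.1 + j.1).choose i : ℚ)) =
      P * P.transpose := by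
    ext i j
    have hv : ((i.1 + j.1).choose i : ℚ) =
        ∑ k ∈ range n, ((i : ℕ).choose k : ℚ) * ((j : ℕ).choose k : ℚ) := by
      rw [add_comm, Nat.add_choose_eq, Nat.sum_antidiagonal_eq_sum_range_succ_mk]
      push_cast
      have hsub : range (i.1 + 1) ⊆ range n := by simp
      refine Finset.sum_subset_zero_on_sdiff hsub ?_ ?_
      · intro k hk
        simp only [mem_sdiff, mem_range] at hk
        rw [Nat.choose_eq_zero_of_lt (by omega : (i : ℕ) < k)]
        simp
      · intro k hk
        rw [mem_range] at hk
        rw [Nat.choose_symm (by omega), mul_comm]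
    rw [Matrix.of_apply, hv, Matrix.mul_apply, Finset.mul_sum, Finset.sum_range]
    refine Finset.sum_congr rfl fun k _ => ?_
    simp only [P, Matrix.transpose_apply, Matrix.of_apply]
    ring
  rw [h, Matrix.det_mul, Matrix.det_transpose, hP, ← Finset.prod_mul_distrib]
  exact Finset.prod_congr rfl fun i _ => by ring

/-- The sequence `k * E_{k-1}`, with exponential generating function `t / cosh t`. -/
noncomputable def kEulerNum (k : ℕ) : ℚ := k * eulerNum (k - 1)

theorem kEulerNum_eq (k : ℕ) :
    kEulerNum k = 2 ^ k * (Polynomial.bernoulli k).eval (1 / 2) -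
      4 ^ k * (Polynomial.bernoulli k).eval (1 / 4) := by
  cases k with
  | zero => simp [kEulerNum]
  | succ k =>
    have h : (k : ℚ) + 1 ≠ 0 := by positivity
    have h4 : (4 : ℚ) ^ (k + 1) = 2 ^ (k + 1) * 2 ^ (k + 1) := by rw [← mul_pow]; norm_num
    rw [kEulerNum, eulerNum, eulerPoly, h4, show (1 / 2 / 2 : ℚ) = 1 / 4 by norm_num]
    push_cast
    field_simp
    ring

/-- The exponential generating function of `k * E_{k-1}`. -/
noncomputable def kEulerSeries : PowerSeries ℚ :=
  PowerSeries.mk fun k => kEulerNum k / k.factorial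

theorem kEulerSeries_mul_exp_add :
    kEulerSeries * (PowerSeries.exp ℚ + PowerSeries.evalNegHom (PowerSeries.exp ℚ)) =
      2 * PowerSeries.X := by
  set e := PowerSeries.exp ℚ with he
  set β : ℚ → PowerSeries ℚ := fun t =>
    PowerSeries.mk fun n => aeval t ((1 / n.factorial : ℚ) • Polynomial.bernoulli n) with hβ
  have hF : kEulerSeries =
      PowerSeries.rescale 2 (β (1 / 2)) - PowerSeries.rescale 4 (β (1 / 4)) := by
    ext k
    simp only [kEulerSeries, hβ, PowerSeries.coeff_mk, map_sub, PowerSeries.coeff_rescale,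
      kEulerNum_eq, map_smul, smul_eq_mul, coe_aeval_eq_eval]
    ring
  have hβt (t s : ℚ) (n : ℕ) (hn : (n : ℚ) = s) (hts : t * s = 1) :
      PowerSeries.rescale s (β t) * (e ^ n - 1) = PowerSeries.C s * PowerSeries.X * e := by
    have h := congrArg (PowerSeries.rescale s) (Polynomial.bernoulli_generating_function t)
    simp only [map_mul, map_sub, map_one, PowerSeries.rescale_X, PowerSeries.rescale_rescale,
      hts, PowerSeries.rescale_one, RingHom.id_apply] at h
    rw [he, PowerSeries.exp_pow_eq_rescale_exp, hn, h]
  have h2 := hβt (1 / 2) 2 2 (by norm_num) (by norm_num)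
  have h4 := hβt (1 / 4) 4 4 (by norm_num) (by norm_num)
  have c2 : (PowerSeries.C (2 : ℚ)) = 2 := map_ofNat _ 2
  have c4 : (PowerSeries.C (4 : ℚ)) = 4 := map_ofNat _ 4
  rw [c2] at h2
  rw [c4] at h4
  have hee : e * PowerSeries.evalNegHom e = 1 := PowerSeries.exp_mul_exp_neg_eq_one
  have hne : e * (e ^ 2 - 1) ≠ 0 := by
    refine mul_ne_zero (left_ne_zero_of_mul_eq_one hee) fun h => ?_
    have := congrArg (PowerSeries.coeff 1) h
    rw [he, PowerSeries.exp_pow_eq_rescale_exp] at this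
    simp [PowerSeries.coeff_rescale, PowerSeries.coeff_exp, PowerSeries.coeff_one] at this
  refine mul_right_cancel₀ hne ?_
  rw [hF]
  linear_combination (e ^ 2 + 1) * h2 - h4 +
    (PowerSeries.rescale 2 (β (1 / 2)) - PowerSeries.rescale 4 (β (1 / 4))) * (e ^ 2 - 1) * hee

theorem kEulerNum_even (k : ℕ) : kEulerNum (2 * k) = 0 := by
  set S := PowerSeries.exp ℚ + PowerSeries.evalNegHom (PowerSeries.exp ℚ) with hS
  have h : kEulerSeries * S = 2 * PowerSeries.X := kEulerSeries_mul_exp_add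
  have hSne : S ≠ 0 := by
    intro h0
    rw [h0, mul_zero] at h
    have := congrArg (PowerSeries.coeff 1) h
    rw [← map_ofNat (PowerSeries.C (R := ℚ)) 2, PowerSeries.coeff_C_mul] at this
    simp at this
  have hSneg : PowerSeries.evalNegHom S = S := by
    rw [hS, map_add, PowerSeries.evalNegHom, PowerSeries.rescale_rescale]
    simp [add_comm]
  have h' := congrArg PowerSeries.evalNegHom h
  rw [map_mul, map_mul, hSneg, PowerSeries.evalNegHom_X, map_ofNat] at h'
  have hneg : PowerSeries.evalNegHom kEulerSeries = -kEulerSeries :=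
    mul_right_cancel₀ hSne (by linear_combination h' + h)
  have hc := congrArg (PowerSeries.coeff (2 * k)) hneg
  simp only [PowerSeries.evalNegHom, PowerSeries.coeff_rescale, kEulerSeries,
    PowerSeries.coeff_mk, map_neg, (even_two_mul k).neg_one_pow] at hc
  have : kEulerNum (2 * k) / ((2 * k).factorial : ℚ) = 0 := by linarith
  simpa [Nat.factorial_ne_zero] using this

theorem momentFunctional_kEulerNum_comp (g : ℚ[X]) :
    momentFunctional kEulerNum (g.comp (X + 1) + g.comp (X - 1)) = 2 * g.coeff 1 := by
  induction g using Polynomial.induction_on' with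
  | add p q hp hq =>
    rw [add_comp, add_comp, coeff_add, mul_add, ← hp, ← hq, ← map_add]
    exact congrArg (momentFunctional kEulerNum) (by ring)
  | monomial n a =>
    have h := congrArg (PowerSeries.coeff n) kEulerSeries_mul_exp_add
    rw [PowerSeries.coeff_mul, Nat.sum_antidiagonal_eq_sum_range_succ_mk,
      ← map_ofNat (PowerSeries.C (R := ℚ)) 2, PowerSeries.coeff_C_mul, PowerSeries.coeff_X] at h
    have hn : (if n = 1 then (1 : ℚ) else 0) = n.factorial * (if n = 1 then (1 : ℚ) else 0) := by
      split_ifs with hn <;> simp [hn]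
    have hexp : (X + 1 : ℚ[X]) ^ n + (X - 1) ^ n =
        ∑ k ∈ range (n + 1), C ((1 + (-1) ^ (n - k)) * (n.choose k : ℚ)) * X ^ k := by
      rw [sub_eq_add_neg, add_pow, add_pow, ← Finset.sum_add_distrib]
      refine Finset.sum_congr rfl fun k _ => ?_
      simp
      ring
    rw [← C_mul_X_pow_eq_monomial, mul_comp, mul_comp, pow_comp, pow_comp, X_comp, X_comp, C_comp,
      C_comp, ← mul_add, momentFunctional_C_mul, hexp, map_sum, coeff_C_mul, coeff_X_pow]
    simp only [momentFunctional_C_mul, momentFunctional_X_pow]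
    simp only [eq_comm (a := 1) (b := n)]
    rw [hn, mul_left_comm 2 a, mul_left_comm 2 (n.factorial : ℚ), ← h]
    simp only [Finset.mul_sum]
    refine Finset.sum_congr rfl fun k hk => congrArg (a * ·) ?_
    have hkn : k ≤ n := Nat.lt_succ_iff.mp (mem_range.mp hk)
    simp only [kEulerSeries, PowerSeries.coeff_mk, map_add, PowerSeries.evalNegHom,
      PowerSeries.coeff_rescale, PowerSeries.coeff_exp, Nat.cast_choose ℚ hkn]
    simp
    field_simp

/-- The linear functional with moments `(2k + 1) E_{2k}`. -/
noncomputable def evenFunctional : ℚ[X] →ₗ[ℚ] ℚ := momentFunctional fun k => kEulerNum (2 * k + 1)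

theorem evenFunctional_eq (p : ℚ[X]) :
    evenFunctional p = momentFunctional kEulerNum (X * p.comp (X ^ 2)) := by
  induction p using Polynomial.induction_on' with
  | add p q hp hq => rw [map_add, hp, hq, ← map_add, add_comp, mul_add]
  | monomial n a =>
    rw [← C_mul_X_pow_eq_monomial, evenFunctional, momentFunctional_C_mul, momentFunctional_X_pow,
      mul_comp, pow_comp, X_comp, C_comp, mul_left_comm, momentFunctional_C_mul, ← pow_mul,
      ← pow_succ', momentFunctional_X_pow]

/-- The monic polynomials `∏_{j<k} (X - (2j+1)^2)`. -/
noncomputable def oddSquares (k : ℕ) : ℚ[X] := ∏ j ∈ range k, (X - C ((2 * j + 1 : ℚ) ^ 2))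

theorem oddSquares_succ (k : ℕ) :
    oddSquares (k + 1) = oddSquares k * (X - C ((2 * k + 1 : ℚ) ^ 2)) :=
  Finset.prod_range_succ _ _

theorem monic_oddSquares (k : ℕ) : (oddSquares k).Monic :=
  monic_prod_of_monic _ _ fun _ _ => monic_X_sub_C _

theorem natDegree_oddSquares (k : ℕ) : (oddSquares k).natDegree = k := by
  rw [oddSquares, natDegree_prod_of_monic _ _ fun _ _ => monic_X_sub_C _]
  simp only [natDegree_X_sub_C, sum_const, card_range, smul_eq_mul, mul_one]

/-- The polynomials `X ∏_{1≤j≤k} (X^2 - (2j)^2)`. -/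
noncomputable def evenSquares (k : ℕ) : ℚ[X] :=
  X * ∏ j ∈ range k, (X ^ 2 - C ((2 * j + 2 : ℚ) ^ 2))

theorem evenSquares_succ (k : ℕ) :
    evenSquares (k + 1) = evenSquares k * (X ^ 2 - C ((2 * k + 2 : ℚ) ^ 2)) := by
  rw [evenSquares, evenSquares, Finset.prod_range_succ, mul_assoc]

theorem evenSquares_comp_add_one (k : ℕ) :
    (evenSquares k).comp (X + 1) = (oddSquares k).comp (X ^ 2) * (X + C (2 * k + 1 : ℚ)) := by
  induction k with
  | zero => simp [evenSquares, oddSquares]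
  | succ k ih =>
    rw [evenSquares_succ, mul_comp, ih, oddSquares_succ, mul_comp]
    simp [map_ofNat]
    ring

theorem evenSquares_comp_sub_one (k : ℕ) :
    (evenSquares k).comp (X - 1) = (oddSquares k).comp (X ^ 2) * (X - C (2 * k + 1 : ℚ)) := by
  induction k with
  | zero => simp [evenSquares, oddSquares]
  | succ k ih =>
    rw [evenSquares_succ, mul_comp, ih, oddSquares_succ, mul_comp]
    simp [map_ofNat]
    ring

theorem evenFunctional_oddSquares_succ (k : ℕ) :
    evenFunctional (oddSquares (k + 1)) = -4 * (k + 1) ^ 2 * evenFunctional (oddSquares k) := by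
  have h := momentFunctional_kEulerNum_comp (X ^ 2 * evenSquares k)
  have h0 : (X ^ 2 * evenSquares k).coeff 1 = 0 := by
    rw [coeff_X_pow_mul']; simp
  have hp : (X ^ 2 * evenSquares k).comp (X + 1) + (X ^ 2 * evenSquares k).comp (X - 1) =
      C 2 * (X * (oddSquares (k + 1) + C (4 * (k + 1 : ℚ) ^ 2) * oddSquares k).comp (X ^ 2)) := by
    rw [mul_comp, mul_comp, evenSquares_comp_add_one, evenSquares_comp_sub_one, oddSquares_succ]
    simp [map_ofNat]
    ring
  rw [hp, h0, momentFunctional_C_mul, ← evenFunctional_eq, map_add] at h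
  rw [show evenFunctional (C (4 * (k + 1 : ℚ) ^ 2) * oddSquares k) =
    4 * (k + 1 : ℚ) ^ 2 * evenFunctional (oddSquares k) from momentFunctional_C_mul _ _ _] at h
  linarith

theorem evenFunctional_oddSquares (k : ℕ) :
    evenFunctional (oddSquares k) = (-4) ^ k * (k.factorial : ℚ) ^ 2 := by
  induction k with
  | zero =>
    have h := momentFunctional_kEulerNum_comp X
    have hX : (X : ℚ[X]).comp (X + 1) + X.comp (X - 1) = C 2 * X ^ 1 := by
      simp [map_ofNat]
      ring
    rw [hX, momentFunctional_C_mul, momentFunctional_X_pow, coeff_X_one] at h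
    rw [evenFunctional_eq]
    simp only [oddSquares, range_zero, prod_empty, one_comp, mul_one]
    rw [← pow_one X, momentFunctional_X_pow]
    simp
    linarith
  | succ k ih =>
    rw [evenFunctional_oddSquares_succ, ih, Nat.factorial_succ]
    push_cast
    ring

theorem evenFunctional_oddSquares_mul (i j : ℕ) :
    evenFunctional (oddSquares i * oddSquares j) =
      (-4) ^ (i + j) * ((i + j).factorial * i.factorial * j.factorial : ℚ) := by
  induction j generalizing i with
  | zero =>
    rw [show oddSquares 0 = 1 by simp [oddSquares], mul_one, evenFunctional_oddSquares]
    simp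
    ring
  | succ j ih =>
    have hp : oddSquares i * oddSquares (j + 1) = oddSquares (i + 1) * oddSquares j +
        C (4 * ((i - j) * (i + j + 1) : ℚ)) * (oddSquares i * oddSquares j) := by
      rw [oddSquares_succ, oddSquares_succ]
      simp [map_ofNat]
      ring
    rw [hp, map_add, ih, show evenFunctional (C (4 * ((i - j) * (i + j + 1) : ℚ)) *
      (oddSquares i * oddSquares j)) = _ from momentFunctional_C_mul _ _ _]
    change _ + _ * evenFunctional _ = _
    rw [ih, show i + 1 + j = i + j + 1 by ring, ← add_assoc, Nat.factorial_succ (i + j),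
      Nat.factorial_succ i, Nat.factorial_succ j]
    push_cast
    ring

theorem hankel_kEulerNum_odd (m : ℕ) :
    hankel (fun k => kEulerNum (2 * k + 1)) m =
      ∏ i ∈ range (m + 1), ((-4) ^ i * (i.factorial : ℚ) ^ 2) ^ 2 := by
  rw [hankel_eq_det_momentFunctional _ oddSquares natDegree_oddSquares monic_oddSquares,
    ← det_choose_add]
  congr 1
  ext i j
  refine (evenFunctional_oddSquares_mul i j).trans ?_
  rw [Matrix.of_apply, Nat.cast_add_choose]
  field_simp
  ring

theorem prod_range_four_pow_mul_factorial (m : ℕ) :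
    (∏ i ∈ range (m + 1), ((-4) ^ i * (i.factorial : ℚ) ^ 2) ^ 2) ^ 2 =
      2 ^ (4 * m * (m + 1)) * ∏ ℓ ∈ Finset.Icc 1 m, ((Nat.factorial ℓ : ℚ)) ^ 8 := by
  induction m with
  | zero => simp
  | succ m ih =>
    rw [Finset.prod_range_succ, mul_pow, ih, Finset.prod_Icc_succ_top (by omega)]
    have h4 : (((-4 : ℚ) ^ (m + 1)) ^ 2) ^ 2 = 2 ^ (8 * (m + 1)) := by
      rw [← pow_mul, ← pow_mul, mul_comm, pow_mul, pow_mul 2 8]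
      norm_num
    rw [mul_pow, mul_pow, h4, show 4 * (m + 1) * (m + 1 + 1) = 4 * m * (m + 1) + 8 * (m + 1) by ring,
      pow_add]
    ring

theorem hankel_k_euler_num (m : ℕ) :
    hankel (fun k => (k : ℚ) * eulerNum (k - 1)) (2 * m) = 0 ∧
    hankel (fun k => (k : ℚ) * eulerNum (k - 1)) (2 * m + 1)
      = (-1 : ℚ) ^ (m + 1) * 2 ^ (4 * m * (m + 1)) *
          ∏ ℓ ∈ Finset.Icc 1 m, ((Nat.factorial ℓ : ℚ)) ^ 8 := by
  refine ⟨hankel_even_eq_zero kEulerNum_even m, (hankel_odd_eq kEulerNum_even m).trans ?_⟩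
  rw [hankel_kEulerNum_odd, prod_range_four_pow_mul_factorial, ← mul_assoc]
end

section
/- Let q ∈ {3, 4, 6} and let χ_q be the character with χ_q(1) = 1, χ_q(q−1) = −1, and χ_q(a) = 0 otherwise for 1 ≤ a ≤ q. Define the generalized Bernoulli numbers B_{k,χ_q} = q^{k−1}(B_k(1/q) − B_k((q−1)/q)). Then for all m ≥ 0, H_{2m}(B_{k,χ_q}) = 0 and H_{2m+1}(B_{k,χ_q}) = (−1)^{m+1} (q^{m−1}(q−2))^{2m+2} · Π_{ℓ=1}^{m} ( ℓ^4((q−2)^2 − (qℓ)^2) / (4(2ℓ+1)(2ℓ−1)) )^{2(m+1−ℓ)}. -/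
/-- The generalized Bernoulli number `B_{k,χ_q}` for the quadratic-type character with
`χ_q(1) = 1`, `χ_q(q-1) = -1` and `0` otherwise, i.e.
`B_{k,χ_q} = q^{k-1} (B_k(1/q) - B_k((q-1)/q))`. -/
noncomputable def genBernoulli (q k : ℕ) : ℚ :=
  (q : ℚ) ^ ((k : ℤ) - 1) *
    ((Polynomial.bernoulli k).eval (1 / (q : ℚ))
      - (Polynomial.bernoulli k).eval (((q : ℚ) - 1) / (q : ℚ)))

open Polynomial Finset

section Determinants

variable {R : Type*} [CommRing R]

theorem LinearMap.map_mul_eq_sum_coeff (M : R[X] →ₗ[R] R) {n : ℕ} {p q : R[X]}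
    (hp : p.natDegree < n) (hq : q.natDegree < n) :
    M (p * q) = ∑ k : Fin n, ∑ l : Fin n, p.coeff k * M (X ^ (k.1 + l.1)) * q.coeff l := by
  conv_lhs => rw [p.as_sum_range_C_mul_X_pow' hp, q.as_sum_range_C_mul_X_pow' hq]
  rw [Finset.sum_mul_sum, map_sum, Finset.sum_range]
  refine Finset.sum_congr rfl fun k _ => ?_
  rw [map_sum, Finset.sum_range]
  refine Finset.sum_congr rfl fun l _ => ?_
  rw [show C (p.coeff k) * X ^ k.1 * (C (q.coeff l) * X ^ l.1)
      = (p.coeff k * q.coeff l) • (X ^ (k.1 + l.1) : R[X]) by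
    rw [smul_eq_C_mul, C_mul]; ring, map_smul, smul_eq_mul]
  ring

/-- The Hankel determinant of the moments of a linear functional can be computed in any pair of
monic polynomial bases. -/
theorem det_moments_eq_det_monic (M : R[X] →ₗ[R] R) (n : ℕ) (p q : ℕ → R[X])
    (hp : ∀ i, (p i).Monic) (hq : ∀ i, (q i).Monic)
    (hpd : ∀ i, (p i).natDegree = i) (hqd : ∀ i, (q i).natDegree = i) :
    (Matrix.of fun i j : Fin n => M (X ^ (i.1 + j.1))).det
      = (Matrix.of fun i j : Fin n => M (p i * q j)).det := by
  have key : (Matrix.of fun i j : Fin n => M (p i * q j))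
      = (Matrix.of fun i j : Fin n => (p j).coeff i).transpose
        * (Matrix.of fun i j : Fin n => M (X ^ (i.1 + j.1)))
        * (Matrix.of fun i j : Fin n => (q j).coeff i) := by
    ext i j
    rw [Matrix.of_apply, M.map_mul_eq_sum_coeff (n := n) (by rw [hpd]; exact i.2)
      (by rw [hqd]; exact j.2), Finset.sum_comm]
    simp only [Matrix.mul_apply, Matrix.transpose_apply, Matrix.of_apply, Finset.sum_mul]
  rw [key, Matrix.det_mul, Matrix.det_mul, Matrix.det_transpose,
    Matrix.det_matrixOfPolynomials (fun i : Fin n => p i) (fun i => hpd i) (fun i => hp i),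
    Matrix.det_matrixOfPolynomials (fun i : Fin n => q i) (fun i => hqd i) (fun i => hq i)]
  ring

theorem det_of_mul_mul_mul {n : ℕ} (s : R) (u v : Fin n → R) (A : Matrix (Fin n) (Fin n) R) :
    (Matrix.of fun i j => s * (u i * (v j * A i j))).det
      = s ^ n * ((∏ i, u i) * ((∏ j, v j) * A.det)) := by
  rw [← Matrix.det_mul_row, ← Matrix.det_mul_column]
  have h := Matrix.det_smul (Matrix.of fun i j => u i * (v j * A i j)) s
  rw [Fintype.card_fin] at h
  exact h

theorem Matrix.det_fromBlocks_antidiagonal {n : Type*} [Fintype n] [DecidableEq n]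
    (A : Matrix n n R) :
    (Matrix.fromBlocks 0 A A 0).det = (-1) ^ Fintype.card n * A.det ^ 2 := by
  have h : Matrix.fromBlocks 1 1 0 1 * Matrix.fromBlocks 0 A A 0
      * Matrix.fromBlocks 1 (-1) 0 1 = Matrix.fromBlocks A 0 A (-A) := by
    simp [Matrix.fromBlocks_multiply]
  have h2 := congrArg Matrix.det h
  rw [Matrix.det_mul, Matrix.det_mul, Matrix.det_fromBlocks_zero₂₁, Matrix.det_fromBlocks_zero₂₁,
    Matrix.det_fromBlocks_zero₁₂, Matrix.det_neg] at h2
  simp only [Matrix.det_one, one_mul, mul_one] at h2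
  rw [h2]
  ring

theorem hankel_two_mul_of_even_eq_zero [NoZeroDivisors R] [CharZero R] (c : ℕ → R)
    (hc : ∀ k, c (2 * k) = 0) (m : ℕ) : hankel c (2 * m) = 0 := by
  have h : (Matrix.of fun i j : Fin (2 * m + 1) => (-1 : R) ^ j.1 *
        (Matrix.of fun i j : Fin (2 * m + 1) => (-1 : R) ^ i.1 * c (i.1 + j.1)) i j)
      = -(Matrix.of fun i j : Fin (2 * m + 1) => c (i.1 + j.1)) := by
    ext i j
    simp only [Matrix.of_apply, Matrix.neg_apply]
    rw [← mul_assoc, ← pow_add, add_comm j.1]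
    rcases Nat.even_or_odd' (i.1 + j.1) with ⟨k, hk | hk⟩
    · rw [hk, hc]; simp
    · rw [hk, pow_succ, pow_mul]; simp
  have h2 := congrArg Matrix.det h
  rw [Matrix.det_mul_row, Matrix.det_neg] at h2
  have h3 := Matrix.det_mul_column (fun i : Fin (2 * m + 1) => (-1 : R) ^ i.1)
    (Matrix.of fun i j : Fin (2 * m + 1) => c (i.1 + j.1))
  simp only [Matrix.of_apply] at h3 h2
  rw [h3, ← mul_assoc, ← Finset.prod_mul_distrib] at h2
  simp only [← mul_pow, neg_mul_neg, one_mul, one_pow, Finset.prod_const_one, Fintype.card_fin]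
    at h2
  rw [pow_succ, pow_mul] at h2
  simp only [even_two, Even.neg_pow, one_pow, one_mul, neg_mul] at h2
  exact self_eq_neg.mp h2

/-- Splitting `Fin (2 * n)` into even and odd indices. -/
def evenOddEquiv (n : ℕ) : Fin n ⊕ Fin n ≃ Fin (2 * n) where
  toFun := Sum.elim (fun i => ⟨2 * i.1, by omega⟩) (fun i => ⟨2 * i.1 + 1, by omega⟩)
  invFun i := if i.1 % 2 = 0 then Sum.inl ⟨i.1 / 2, by omega⟩ else Sum.inr ⟨i.1 / 2, by omega⟩
  left_inv := by
    rintro (i | i)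
    · simp
    · have : (2 * i.1 + 1) / 2 = i.1 := by omega
      simp [this]
  right_inv i := by
    by_cases h : i.1 % 2 = 0
    · simp only [h, if_true, Sum.elim_inl]; ext; simp; omega
    · simp only [h, if_false, Sum.elim_inr]; ext; simp; omega

theorem hankel_two_mul_add_one_of_even_eq_zero (c : ℕ → R) (hc : ∀ k, c (2 * k) = 0) (m : ℕ) :
    hankel c (2 * m + 1) = (-1) ^ (m + 1) *
      (Matrix.of fun i j : Fin (m + 1) => c (2 * (i.1 + j.1) + 1)).det ^ 2 := by
  have h := Matrix.det_fromBlocks_antidiagonal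
    (Matrix.of fun i j : Fin (m + 1) => c (2 * (i.1 + j.1) + 1))
  rw [Fintype.card_fin] at h
  rw [← h, hankel, ← Matrix.det_submatrix_equiv_self (evenOddEquiv (m + 1))]
  congr 1
  ext (i | i) (j | j)
  · simpa [evenOddEquiv, mul_add] using hc (i.1 + j.1)
  · simp only [evenOddEquiv, Matrix.submatrix_apply, Matrix.of_apply, Matrix.fromBlocks_apply₁₂,
      Equiv.coe_fn_mk, Sum.elim_inl, Sum.elim_inr]
    congr 1; ring
  · simp only [evenOddEquiv, Matrix.submatrix_apply, Matrix.of_apply, Matrix.fromBlocks_apply₂₁,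
      Equiv.coe_fn_mk, Sum.elim_inl, Sum.elim_inr]
    congr 1; ring
  · simp only [evenOddEquiv, Matrix.submatrix_apply, Matrix.of_apply, Matrix.fromBlocks_apply₂₂,
      Equiv.coe_fn_mk, Sum.elim_inr, Matrix.zero_apply]
    rw [← hc (i.1 + j.1 + 1)]
    congr 1; ring

end Determinants

section Hilbert

/-- The determinant of the `n × n` Hilbert matrix. -/
noncomputable def hilbertDet (n : ℕ) : ℚ :=
  (Matrix.of fun i j : Fin n => 1 / ((i.1 : ℚ) + j.1 + 1)).det

theorem hilbertDet_succ (n : ℕ) :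
    hilbertDet (n + 1) = (∏ i ∈ range n, ((i : ℚ) - n) / (i + n + 1)) ^ 2 / (2 * n + 1)
      * hilbertDet n := by
  have hn : (2 * n + 1 : ℚ) ≠ 0 := by positivity
  have hblocks : (Matrix.of fun i j : Fin (n + 1) => 1 / ((i.1 : ℚ) + j.1 + 1)).submatrix
        (finSumFinEquiv (m := n) (n := 1)) (finSumFinEquiv (m := n) (n := 1))
      = Matrix.fromBlocks (Matrix.of fun i j : Fin n => 1 / ((i.1 : ℚ) + j.1 + 1))
        (Matrix.of fun (i : Fin n) (_ : Fin 1) => 1 / ((i.1 : ℚ) + n + 1))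
        (Matrix.of fun (_ : Fin 1) (j : Fin n) => 1 / ((n : ℚ) + j.1 + 1))
        (Matrix.diagonal fun _ => 1 / (2 * n + 1 : ℚ)) := by
    ext (i | i) (j | j)
    · simp
    · simp
    · simp
    · have hij : i = j := Subsingleton.elim _ _
      subst hij
      simp
      ring
  let : Invertible (Matrix.diagonal fun _ : Fin 1 => 1 / (2 * n + 1 : ℚ)) :=
    ⟨Matrix.diagonal fun _ => (2 * n + 1 : ℚ), by simp [hn], by simp [hn]⟩
  have hinv : ⅟(Matrix.diagonal fun _ : Fin 1 => 1 / (2 * n + 1 : ℚ))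
      = Matrix.diagonal fun _ => (2 * n + 1 : ℚ) := rfl
  rw [hilbertDet, ← Matrix.det_submatrix_equiv_self (finSumFinEquiv (m := n) (n := 1)), hblocks,
    Matrix.det_fromBlocks₂₂, hinv]
  have hschur : (Matrix.of fun i j : Fin n => 1 / ((i.1 : ℚ) + j.1 + 1))
      - (Matrix.of fun (i : Fin n) (_ : Fin 1) => 1 / ((i.1 : ℚ) + n + 1) :
          Matrix (Fin n) (Fin 1) ℚ)
        * (Matrix.diagonal fun _ => (2 * n + 1 : ℚ) : Matrix (Fin 1) (Fin 1) ℚ)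
        * (Matrix.of fun (_ : Fin 1) (j : Fin n) => 1 / ((n : ℚ) + j.1 + 1) :
          Matrix (Fin 1) (Fin n) ℚ)
      = Matrix.of fun i j : Fin n => (((i.1 : ℚ) - n) / (i.1 + n + 1)) *
        (Matrix.of fun i j : Fin n => (((j.1 : ℚ) - n) / (j.1 + n + 1)) *
          (Matrix.of fun i j : Fin n => 1 / ((i.1 : ℚ) + j.1 + 1)) i j) i j := by
    ext i j
    have h1 : ((i.1 : ℚ) + j.1 + 1) ≠ 0 := by positivity
    have h2 : ((i.1 : ℚ) + n + 1) ≠ 0 := by positivity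
    have h3 : ((j.1 : ℚ) + n + 1) ≠ 0 := by positivity
    have h4 : ((n : ℚ) + j.1 + 1) ≠ 0 := by positivity
    simp only [Matrix.sub_apply, Matrix.of_apply, Matrix.mul_apply, Finset.univ_unique,
      Finset.sum_singleton, Matrix.diagonal_apply_eq]
    field_simp
    ring
  rw [hschur, Matrix.det_mul_column, Matrix.det_mul_row, Matrix.det_diagonal]
  rw [Fin.prod_univ_eq_prod_range (fun i : ℕ => ((i : ℚ) - n) / (i + n + 1)), hilbertDet]
  simp
  ring

theorem hilbert_ratio_eq_prod (n : ℕ) :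
    (∏ i ∈ range n, ((i : ℚ) - n) / (i + n + 1)) ^ 2 / (2 * n + 1)
      = ∏ i ∈ range n, ((i : ℚ) + 1) ^ 2 / (4 * (2 * (i + 1) + 1) * (2 * (i + 1) - 1)) := by
  induction n with
  | zero => simp
  | succ n ih =>
    have hnum : ∏ i ∈ range (n + 1), ((i : ℚ) - (n + 1 : ℕ))
        = -(n + 1) * ∏ i ∈ range n, ((i : ℚ) - n) := by
      rw [Finset.prod_range_succ']
      push_cast
      simp only [add_sub_add_right_eq_sub]
      ring
    have hden : ((n : ℚ) + 1) * ∏ i ∈ range (n + 1), ((i : ℚ) + (n + 1 : ℕ) + 1)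
        = (∏ i ∈ range n, ((i : ℚ) + n + 1)) * (2 * n + 1) * (2 * n + 2) := by
      have h := Finset.prod_range_succ' (fun i : ℕ => (i : ℚ) + n + 1) (n + 1)
      rw [Finset.prod_range_succ, Finset.prod_range_succ] at h
      rw [show (∏ i ∈ range (n + 1), ((i : ℚ) + (n + 1 : ℕ) + 1))
        = ∏ i ∈ range (n + 1), (((i + 1 : ℕ) : ℚ) + n + 1) from
          Finset.prod_congr rfl fun i _ => by push_cast; ring]
      push_cast at h ⊢
      linear_combination -h
    have hn : (n + 1 : ℚ) ≠ 0 := by positivity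
    have hratio : ∏ i ∈ range (n + 1), ((i : ℚ) - (n + 1 : ℕ)) / (i + (n + 1 : ℕ) + 1)
        = (∏ i ∈ range n, ((i : ℚ) - n) / (i + n + 1)) * (-(n + 1) / (2 * (2 * n + 1))) := by
      have hd : (∏ i ∈ range n, ((i : ℚ) + n + 1)) ≠ 0 :=
        Finset.prod_ne_zero_iff.mpr fun i _ => by positivity
      rw [Finset.prod_div_distrib, Finset.prod_div_distrib, hnum,
        (eq_div_iff hn).mpr ((mul_comm _ _).trans hden)]
      have : (2 * n + 1 : ℚ) ≠ 0 := by positivity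
      field_simp
    rw [hratio, Finset.prod_range_succ, ← ih]
    have h1 : (2 * n + 1 : ℚ) ≠ 0 := by positivity
    have h2 : (2 * (n + 1) + 1 : ℚ) ≠ 0 := by positivity
    rw [show (2 * ((n : ℚ) + 1) - 1) = 2 * n + 1 by ring]
    push_cast
    field_simp
    ring

end Hilbert

section BernoulliFunctional

/-- The linear functional sending `X ^ n` to `B_n(a)`. -/
noncomputable def bernoulliFunctional (a : ℚ) : ℚ[X] →ₗ[ℚ] ℚ :=
  Polynomial.lsum fun n => ((Polynomial.bernoulli n).eval a) • LinearMap.id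

theorem bernoulliFunctional_X_pow (a : ℚ) (n : ℕ) :
    bernoulliFunctional a (X ^ n) = (Polynomial.bernoulli n).eval a := by
  rw [bernoulliFunctional, Polynomial.lsum_apply, X_pow_eq_monomial, sum_monomial_index] <;> simp

theorem bernoulliFunctional_comp_X_add_one_sub (a : ℚ) (f : ℚ[X]) :
    bernoulliFunctional a (f.comp (X + 1) - f) = f.derivative.eval a := by
  induction f using Polynomial.induction_on' with
  | add f g hf hg =>
    rw [add_comp, derivative_add, eval_add, ← hf, ← hg, ← map_add]
    congr 1; ring
  | monomial n c =>
    rw [← C_mul_X_pow_eq_monomial, mul_comp, C_comp, ← mul_sub, ← smul_eq_C_mul, map_smul,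
      derivative_C_mul, eval_mul, eval_C, smul_eq_mul, X_pow_comp]
    congr 1
    cases n with
    | zero => simp
    | succ n =>
      have h := congrArg (eval a) (Polynomial.sum_bernoulli n)
      rw [add_pow, Finset.sum_range_succ]
      simp only [one_pow, mul_one, Nat.choose_self, Nat.cast_one, add_sub_cancel_right, map_sum]
      rw [eval_finsetSum, eval_monomial] at h
      rw [derivative_X_pow, eval_mul, eval_C, eval_pow, eval_X, Nat.add_sub_cancel,
        Nat.cast_add_one, ← h]
      refine Finset.sum_congr rfl fun k _ => ?_
      rw [eval_smul, ← bernoulliFunctional_X_pow, ← map_smul, smul_eq_C_mul, mul_comm,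
        C_eq_natCast]

/-- The linear functional sending `X ^ n` to `B_{2n+1}(a)`. -/
noncomputable def oddBernoulliFunctional (a : ℚ) : ℚ[X] →ₗ[ℚ] ℚ :=
  bernoulliFunctional a ∘ₗ LinearMap.mulLeft ℚ X ∘ₗ (aeval (X ^ 2 : ℚ[X])).toLinearMap

theorem oddBernoulliFunctional_apply (a : ℚ) (f : ℚ[X]) :
    oddBernoulliFunctional a f = bernoulliFunctional a (X * f.comp (X ^ 2)) := by
  rfl

theorem oddBernoulliFunctional_X_pow (a : ℚ) (n : ℕ) :
    oddBernoulliFunctional a (X ^ n) = (Polynomial.bernoulli (2 * n + 1)).eval a := by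
  rw [oddBernoulliFunctional_apply, X_pow_comp, ← bernoulliFunctional_X_pow]
  congr 1
  ring

/-- The monic polynomial `∏_{j<k} (X - (a + j)²)`. -/
noncomputable def shiftedSquares (a : ℚ) (k : ℕ) : ℚ[X] :=
  ∏ j ∈ range k, (X - C ((a + j) ^ 2))

theorem shiftedSquares_monic (a : ℚ) (k : ℕ) : (shiftedSquares a k).Monic :=
  monic_prod_of_monic _ _ fun _ _ => monic_X_sub_C _

theorem shiftedSquares_natDegree (a : ℚ) (k : ℕ) : (shiftedSquares a k).natDegree = k := by
  rw [shiftedSquares, natDegree_prod_of_monic _ _ fun _ _ => monic_X_sub_C _]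
  simp only [natDegree_X_sub_C, sum_const, card_range, smul_eq_mul, mul_one]

theorem shiftedSquares_succ (a : ℚ) (k : ℕ) :
    shiftedSquares a (k + 1) = shiftedSquares a k * (X - C ((a + k) ^ 2)) :=
  Finset.prod_range_succ _ _

theorem eval_shiftedSquares_add_half (a y : ℚ) (k : ℕ) :
    (shiftedSquares (a - 1 / 2) (k + 1)).eval ((y + 1 / 2) ^ 2)
      = (shiftedSquares a k).eval (y ^ 2) * ((y - (a - 1)) * (y + a + k)) := by
  induction k with
  | zero => simp [shiftedSquares]; ring
  | succ k ih =>
    rw [shiftedSquares_succ, eval_mul, ih, shiftedSquares_succ a, eval_mul]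
    simp
    ring

theorem eval_shiftedSquares_sub_half (a y : ℚ) (k : ℕ) :
    (shiftedSquares (a - 1 / 2) (k + 1)).eval ((y - 1 / 2) ^ 2)
      = (shiftedSquares a k).eval (y ^ 2) * ((y + (a - 1)) * (y - a - k)) := by
  have h := eval_shiftedSquares_add_half a (-y) k
  rw [show (-y + 1 / 2) ^ 2 = (y - 1 / 2) ^ 2 by ring, neg_sq] at h
  rw [h]
  ring

theorem eval_shiftedSquares_self (a : ℚ) (k : ℕ) :
    (shiftedSquares a (k + 1)).eval (a ^ 2) = 0 := by
  rw [shiftedSquares, eval_prod]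
  exact Finset.prod_eq_zero (Finset.mem_range.mpr k.succ_pos) (by simp)

theorem oddBernoulliFunctional_X_mul (a : ℚ) (k j : ℕ) :
    ((k : ℚ) + j + 2) * oddBernoulliFunctional a
        (shiftedSquares a k * shiftedSquares (1 - a) j * X)
      = -(((k : ℚ) + 1) * a * (1 - a + j) + (j + 1) * (1 - a) * (a + k))
        * oddBernoulliFunctional a (shiftedSquares a k * shiftedSquares (1 - a) j) := by
  set F : ℚ[X] := (shiftedSquares (a - 1 / 2) (k + 1)).comp ((X - C (1 / 2)) ^ 2)
    * (shiftedSquares (1 - a - 1 / 2) (j + 1)).comp ((X - C (1 / 2)) ^ 2) with hF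
  have hder : F.derivative.eval a = 0 := by
    have h1 := eval_shiftedSquares_self (a - 1 / 2) k
    have h2 := eval_shiftedSquares_self (1 - a - 1 / 2) j
    rw [show (1 - a - 1 / 2) ^ 2 = (a - 1 / 2) ^ 2 by ring] at h2
    rw [hF, derivative_mul]
    simp only [eval_add, eval_mul, eval_comp, eval_pow, eval_sub, eval_X, eval_C, h1, h2]
    ring
  have hdiff : F.comp (X + 1) - F = (2 : ℚ) •
      (((k : ℚ) + j + 2) • (X * (shiftedSquares a k * shiftedSquares (1 - a) j * X).comp (X ^ 2))
      + (((k : ℚ) + 1) * a * (1 - a + j) + (j + 1) * (1 - a) * (a + k)) •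
        (X * (shiftedSquares a k * shiftedSquares (1 - a) j).comp (X ^ 2))) := by
    apply Polynomial.funext
    intro y
    have e1 := eval_shiftedSquares_add_half a y k
    have e2 := eval_shiftedSquares_add_half (1 - a) y j
    have e3 := eval_shiftedSquares_sub_half a y k
    have e4 := eval_shiftedSquares_sub_half (1 - a) y j
    rw [hF]
    simp only [eval_add, eval_mul, eval_comp, eval_pow, eval_sub, eval_X, eval_C, eval_smul,
      eval_one, smul_eq_mul]
    rw [show y + 1 - 1 / 2 = y + 1 / 2 by ring, e1, e2, e3, e4]
    ring
  have h := bernoulliFunctional_comp_X_add_one_sub a F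
  rw [hder, hdiff, map_smul, map_add, map_smul, map_smul, ← oddBernoulliFunctional_apply,
    ← oddBernoulliFunctional_apply] at h
  simp only [smul_eq_mul] at h
  linear_combination h / 2

theorem oddBernoulliFunctional_shiftedSquares_succ_right (a : ℚ) (k j : ℕ) :
    ((k : ℚ) + j + 2) * oddBernoulliFunctional a
        (shiftedSquares a k * shiftedSquares (1 - a) (j + 1))
      = -(((k : ℚ) + j + 1) * ((j + 1) * (2 * (1 - a) + j)))
        * oddBernoulliFunctional a (shiftedSquares a k * shiftedSquares (1 - a) j) := by
  have h := oddBernoulliFunctional_X_mul a k j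
  rw [shiftedSquares_succ, show shiftedSquares a k *
      (shiftedSquares (1 - a) j * (X - C ((1 - a + j) ^ 2)))
      = shiftedSquares a k * shiftedSquares (1 - a) j * X
        - ((1 - a + j) ^ 2) • (shiftedSquares a k * shiftedSquares (1 - a) j) by
    rw [smul_eq_C_mul]; ring, map_sub, map_smul, smul_eq_mul]
  linear_combination h

theorem oddBernoulliFunctional_shiftedSquares_succ_left (a : ℚ) (k j : ℕ) :
    ((k : ℚ) + j + 2) * oddBernoulliFunctional a
        (shiftedSquares a (k + 1) * shiftedSquares (1 - a) j)
      = -(((k : ℚ) + j + 1) * ((k + 1) * (2 * a + k)))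
        * oddBernoulliFunctional a (shiftedSquares a k * shiftedSquares (1 - a) j) := by
  have h := oddBernoulliFunctional_X_mul a k j
  rw [shiftedSquares_succ, show shiftedSquares a k * (X - C ((a + k) ^ 2)) *
      shiftedSquares (1 - a) j
      = shiftedSquares a k * shiftedSquares (1 - a) j * X
        - ((a + k) ^ 2) • (shiftedSquares a k * shiftedSquares (1 - a) j) by
    rw [smul_eq_C_mul]; ring, map_sub, map_smul, smul_eq_mul]
  linear_combination h

theorem oddBernoulliFunctional_shiftedSquares (a : ℚ) (k j : ℕ) :
    oddBernoulliFunctional a (shiftedSquares a k * shiftedSquares (1 - a) j)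
      = (a - 1 / 2) * ((∏ i ∈ range k, -(((i : ℚ) + 1) * (2 * a + i))) *
        ((∏ i ∈ range j, -(((i : ℚ) + 1) * (2 * (1 - a) + i))) * (1 / ((k : ℚ) + j + 1)))) := by
  induction j with
  | zero =>
    induction k with
    | zero =>
      have h := oddBernoulliFunctional_X_pow a 0
      rw [pow_zero] at h
      simp [shiftedSquares, h]
    | succ k ih =>
      have h := oddBernoulliFunctional_shiftedSquares_succ_left a k 0
      have h1 : ((k : ℚ) + 1) ≠ 0 := by positivity
      have h2 : ((k : ℚ) + 2) ≠ 0 := by positivity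
      have h3 : ((k : ℚ) + 1 + 1) ≠ 0 := by positivity
      rw [ih] at h
      rw [Finset.prod_range_succ _ k]
      simp only [Nat.cast_zero, add_zero, Nat.cast_add, Nat.cast_one] at h ⊢
      apply mul_left_cancel₀ h2
      rw [h]
      field_simp
      ring
  | succ j ih =>
    have h := oddBernoulliFunctional_shiftedSquares_succ_right a k j
    have h1 : ((k : ℚ) + j + 1) ≠ 0 := by positivity
    have h2 : ((k : ℚ) + j + 2) ≠ 0 := by positivity
    have h3 : ((k : ℚ) + (j + 1) + 1) ≠ 0 := by positivity
    rw [ih] at h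
    rw [Finset.prod_range_succ _ j]
    simp only [Nat.cast_add, Nat.cast_one] at h ⊢
    apply mul_left_cancel₀ h2
    rw [h]
    field_simp
    ring

theorem det_bernoulli_odd (a : ℚ) (n : ℕ) :
    (Matrix.of fun i j : Fin n => (Polynomial.bernoulli (2 * (i.1 + j.1) + 1)).eval a).det
      = (a - 1 / 2) ^ n *
        (∏ k ∈ range n, ∏ i ∈ range k,
          (((i : ℚ) + 1) ^ 2 * ((2 * a + i) * (2 * (1 - a) + i)))) * hilbertDet n := by
  simp only [← oddBernoulliFunctional_X_pow]
  rw [det_moments_eq_det_monic _ n (shiftedSquares a) (shiftedSquares (1 - a))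
    (shiftedSquares_monic _) (shiftedSquares_monic _) (shiftedSquares_natDegree _)
    (shiftedSquares_natDegree _)]
  simp only [oddBernoulliFunctional_shiftedSquares]
  have hscale := det_of_mul_mul_mul (a - 1 / 2)
    (fun k : Fin n => ∏ i ∈ range k.1, -(((i : ℚ) + 1) * (2 * a + i)))
    (fun j : Fin n => ∏ i ∈ range j.1, -(((i : ℚ) + 1) * (2 * (1 - a) + i)))
    (Matrix.of fun k j : Fin n => 1 / ((k.1 : ℚ) + j.1 + 1))
  simp only [Matrix.of_apply] at hscale
  rw [hscale, hilbertDet,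
    Fin.prod_univ_eq_prod_range (fun k => ∏ i ∈ range k, -(((i : ℚ) + 1) * (2 * a + i))),
    Fin.prod_univ_eq_prod_range (fun k => ∏ i ∈ range k, -(((i : ℚ) + 1) * (2 * (1 - a) + i))),
    ← mul_assoc (∏ k ∈ range n, _), ← Finset.prod_mul_distrib]
  simp only [← Finset.prod_mul_distrib]
  rw [← mul_assoc]
  congr 2
  refine Finset.prod_congr rfl fun k _ => Finset.prod_congr rfl fun i _ => ?_
  ring

end BernoulliFunctional

section GenBernoulli

theorem genBernoulli_eq {q : ℕ} (hq : q ≠ 0) (k : ℕ) :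
    genBernoulli q k = (q : ℚ) ^ ((k : ℤ) - 1) *
      ((1 - (-1) ^ k) * (Polynomial.bernoulli k).eval (1 / (q : ℚ))) := by
  have hq' : (q : ℚ) ≠ 0 := by exact_mod_cast hq
  rw [genBernoulli, show ((q : ℚ) - 1) / q = 1 - 1 / q by field_simp,
    Polynomial.bernoulli_eval_one_sub]
  ring

theorem genBernoulli_even {q : ℕ} (hq : q ≠ 0) (k : ℕ) : genBernoulli q (2 * k) = 0 := by
  rw [genBernoulli_eq hq, pow_mul]
  simp

theorem genBernoulli_odd {q : ℕ} (hq : q ≠ 0) (k : ℕ) :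
    genBernoulli q (2 * k + 1)
      = 2 * (q : ℚ) ^ (2 * k) * (Polynomial.bernoulli (2 * k + 1)).eval (1 / (q : ℚ)) := by
  rw [genBernoulli_eq hq, show ((2 * k + 1 : ℕ) : ℤ) - 1 = ((2 * k : ℕ) : ℤ) by push_cast; ring,
    zpow_natCast, pow_succ, pow_mul (-1 : ℚ)]
  norm_num
  ring

theorem det_genBernoulli_odd {q : ℕ} (hq : q ≠ 0) (n : ℕ) :
    (Matrix.of fun i j : Fin n => genBernoulli q (2 * (i.1 + j.1) + 1)).det
      = 2 ^ n * (∏ k ∈ range n, (q : ℚ) ^ (4 * k)) *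
        (Matrix.of fun i j : Fin n =>
          (Polynomial.bernoulli (2 * (i.1 + j.1) + 1)).eval (1 / (q : ℚ))).det := by
  have h := Matrix.det_mul_column (fun i : Fin n => 2 * (q : ℚ) ^ (2 * i.1))
    (Matrix.of fun i j : Fin n => (q : ℚ) ^ (2 * j.1) *
      (Matrix.of fun i j : Fin n =>
        (Polynomial.bernoulli (2 * (i.1 + j.1) + 1)).eval (1 / (q : ℚ))) i j)
  rw [Matrix.det_mul_row, ← mul_assoc, ← Finset.prod_mul_distrib,
    Fin.prod_univ_eq_prod_range (fun k => 2 * (q : ℚ) ^ (2 * k) * (q : ℚ) ^ (2 * k))] at h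
  simp only [Matrix.of_apply] at h
  simp only [genBernoulli_odd hq]
  convert h using 2
  · ext i j
    simp only [Matrix.of_apply]
    ring
  · rw [← Finset.card_range n, ← Finset.prod_const, Finset.card_range, ← Finset.prod_mul_distrib]
    refine Finset.prod_congr rfl fun k _ => ?_
    ring

theorem det_genBernoulli_odd_succ {q : ℕ} (hq : q ≠ 0) (n : ℕ) :
    (Matrix.of fun i j : Fin (n + 1) => genBernoulli q (2 * (i.1 + j.1) + 1)).det
      = (-1) ^ (n + 1) * ((q : ℚ) ^ (2 * (n : ℤ) - 1) * (q - 2)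
        * ∏ i ∈ range n, (((i + 1 : ℕ) : ℚ) ^ 4 * (((q : ℚ) - 2) ^ 2 - (q * (i + 1 : ℕ)) ^ 2)
          / (4 * (2 * ((i + 1 : ℕ) : ℚ) + 1) * (2 * ((i + 1 : ℕ) : ℚ) - 1))))
        * (Matrix.of fun i j : Fin n => genBernoulli q (2 * (i.1 + j.1) + 1)).det := by
  have hq' : (q : ℚ) ≠ 0 := by exact_mod_cast hq
  have hfactor : (-1) ^ n * ∏ i ∈ range n,
        (((i + 1 : ℕ) : ℚ) ^ 4 * (((q : ℚ) - 2) ^ 2 - (q * (i + 1 : ℕ)) ^ 2)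
          / (4 * (2 * ((i + 1 : ℕ) : ℚ) + 1) * (2 * ((i + 1 : ℕ) : ℚ) - 1)))
      = (q : ℚ) ^ (2 * n) * (∏ i ∈ range n,
          (((i : ℚ) + 1) ^ 2 * ((2 * (1 / (q : ℚ)) + i) * (2 * (1 - 1 / (q : ℚ)) + i))))
        * ((∏ i ∈ range n, ((i : ℚ) - n) / (i + n + 1)) ^ 2 / (2 * n + 1)) := by
    rw [hilbert_ratio_eq_prod, pow_mul]
    have hc (c : ℚ) : c ^ n = ∏ _i ∈ range n, c := by simp
    rw [hc, hc, ← Finset.prod_mul_distrib, ← Finset.prod_mul_distrib, ← Finset.prod_mul_distrib]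
    refine Finset.prod_congr rfl fun i _ => ?_
    have h1 : (2 * ((i : ℚ) + 1) + 1) ≠ 0 := by positivity
    have h2 : (2 * ((i : ℚ) + 1) - 1) ≠ 0 := by
      rw [show (2 * ((i : ℚ) + 1) - 1) = 2 * i + 1 by ring]; positivity
    push_cast
    field_simp
    ring
  have hpow : (q : ℚ) ^ (2 * (n : ℤ) - 1) = (q : ℚ) ^ (2 * n) / q := by
    rw [zpow_sub_one₀ hq', div_eq_mul_inv]
    norm_cast
  rw [det_genBernoulli_odd hq, det_genBernoulli_odd hq, det_bernoulli_odd, det_bernoulli_odd,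
    hilbertDet_succ, Finset.prod_range_succ, Finset.prod_range_succ, hpow, pow_succ (-1 : ℚ),
    show ∀ s u v w D : ℚ, s * -1 * (u * v * w) * D = -(u * v * (s * w) * D) by intros; ring,
    hfactor]
  have ha : (q : ℚ) - 2 = -2 * q * (1 / q - 1 / 2) := by field_simp; ring
  rw [ha]
  generalize (∏ i ∈ range n, ((i : ℚ) - n) / (i + n + 1)) ^ 2 / (2 * n + 1) = h
  generalize (∏ i ∈ range n,
    (((i : ℚ) + 1) ^ 2 * ((2 * (1 / (q : ℚ)) + i) * (2 * (1 - 1 / (q : ℚ)) + i)))) = w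
  generalize (∏ k ∈ range n, ∏ i ∈ range k,
    (((i : ℚ) + 1) ^ 2 * ((2 * (1 / (q : ℚ)) + i) * (2 * (1 - 1 / (q : ℚ)) + i)))) = D
  generalize (1 / (q : ℚ) - 1 / 2) = d
  field_simp
  ring

end GenBernoulli

theorem hankel_genBernoulli (q : ℕ) (hq : q = 3 ∨ q = 4 ∨ q = 6) (m : ℕ) :
    hankel (genBernoulli q) (2 * m) = 0 ∧
    hankel (genBernoulli q) (2 * m + 1)
      = (-1 : ℚ) ^ (m + 1) * ((q : ℚ) ^ ((m : ℤ) - 1) * ((q : ℚ) - 2)) ^ (2 * m + 2) *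
        ∏ ℓ ∈ Finset.Icc 1 m,
          ((ℓ : ℚ) ^ 4 * (((q : ℚ) - 2) ^ 2 - ((q : ℚ) * ℓ) ^ 2)
              / (4 * (2 * (ℓ : ℚ) + 1) * (2 * (ℓ : ℚ) - 1))) ^ (2 * (m + 1 - ℓ)) := by
  have hq0 : q ≠ 0 := by rcases hq with rfl | rfl | rfl <;> norm_num
  have hq' : (q : ℚ) ≠ 0 := by exact_mod_cast hq0
  refine ⟨hankel_two_mul_of_even_eq_zero _ (genBernoulli_even hq0) m, ?_⟩
  rw [hankel_two_mul_add_one_of_even_eq_zero _ (genBernoulli_even hq0), mul_assoc]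
  congr 1
  induction m with
  | zero =>
    rw [det_genBernoulli_odd_succ hq0]
    simp
  | succ m ih =>
    rw [det_genBernoulli_odd_succ hq0, mul_pow, ih, mul_pow, ← pow_mul, mul_comm (m + 1 + 1) 2,
      pow_mul (-1 : ℚ)]
    set r : ℕ → ℚ := fun ℓ => (ℓ : ℚ) ^ 4 * (((q : ℚ) - 2) ^ 2 - ((q : ℚ) * ℓ) ^ 2)
      / (4 * (2 * (ℓ : ℚ) + 1) * (2 * (ℓ : ℚ) - 1))
    have hprod : ∏ ℓ ∈ Finset.Icc 1 (m + 1), r ℓ ^ (2 * (m + 1 + 1 - ℓ))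
        = (∏ i ∈ range (m + 1), r (i + 1)) ^ 2
          * ∏ ℓ ∈ Finset.Icc 1 m, r ℓ ^ (2 * (m + 1 - ℓ)) := by
      have hrange : ∏ i ∈ range (m + 1), r (i + 1) = ∏ ℓ ∈ Finset.Icc 1 (m + 1), r ℓ := by
        rw [Finset.range_eq_Ico, Finset.prod_Ico_add' r 0 (m + 1) 1]
        rfl
      rw [hrange, Finset.prod_Icc_succ_top (by omega), Finset.prod_Icc_succ_top (by omega),
        mul_pow, ← Finset.prod_pow, mul_right_comm, ← Finset.prod_mul_distrib]
      congr 1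
      · refine Finset.prod_congr rfl fun ℓ hℓ => ?_
        rw [← pow_add]
        congr 1
        have := Finset.mem_Icc.mp hℓ
        omega
      · congr 1
        omega
    have hpow : ((q : ℚ) ^ (((m + 1 : ℕ) : ℤ) - 1) * ((q : ℚ) - 2)) ^ (2 * (m + 1) + 2)
        = ((q : ℚ) ^ (2 * ((m + 1 : ℕ) : ℤ) - 1) * ((q : ℚ) - 2)) ^ 2
          * ((q : ℚ) ^ ((m : ℤ) - 1) * ((q : ℚ) - 2)) ^ (2 * m + 2) := by
      have h1 : (q : ℚ) ^ (((m + 1 : ℕ) : ℤ) - 1) = (q : ℚ) ^ m := by simp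
      have h2 : (q : ℚ) ^ (2 * ((m + 1 : ℕ) : ℤ) - 1) = (q : ℚ) ^ (2 * m + 1) := by
        rw [← zpow_natCast]; congr 1; push_cast; ring
      rw [h1, h2, zpow_sub_one₀ hq', zpow_natCast, ← div_eq_mul_inv]
      generalize (q : ℚ) - 2 = s
      simp only [mul_pow, div_pow]
      field_simp
      ring
    rw [hprod, hpow]
    simp only [even_two, Even.neg_pow, one_pow, one_mul]
    ring
end

section
/- For an integer s ≥ 1 let S_k(s) = k(1^{k−1} + 2^{k−1} + ... + s^{k−1}) for k ≥ 1 and S_0(s) = 0 (equivalently S_k(s) = B_k(1+s) − B_k(1)). Then for all integers m ≥ 0, H_{2m}(S_k(s)) = 0 and H_{2m+1}(S_k(s)) = (−s^2)^{m+1} · Π_{ℓ=1}^{m} ( ℓ^4(s^2 − ℓ^2) / (4(2ℓ+1)(2ℓ−1)) )^{2(m+1−ℓ)}. In particular H_{2m+1}(S_k(s)) = 0 for all m ≥ s. -/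
/-- `S_k(s) = k (1^{k-1} + 2^{k-1} + ⋯ + s^{k-1})` for `k ≥ 1`, with `S_0(s) = 0`. -/
noncomputable def powerSum (s k : ℕ) : ℚ :=
  (k : ℚ) * ∑ j ∈ Finset.Icc 1 s, (j : ℚ) ^ (k - 1)

open Polynomial Finset

/-- The Hankel matrix of the moments of a linear functional is congruent, through unitriangular
matrices, to the Gram matrix of any two monic polynomial sequences. -/
theorem hankel_eq_det_of_monic {R : Type*} [CommRing R] [Nontrivial R] (L : R[X] →ₗ[R] R)
    (p q : ℕ → R[X]) (hp : ∀ i, (p i).Monic) (hq : ∀ i, (q i).Monic)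
    (hpd : ∀ i, (p i).natDegree = i) (hqd : ∀ i, (q i).natDegree = i) (n : ℕ) :
    hankel (fun k => L (X ^ k)) n
      = (Matrix.of fun i j : Fin (n + 1) => L (p i * q j)).det := by
  have expand : ∀ (r : R[X]), ∀ j : Fin (n + 1), r.natDegree = j →
      r = ∑ k : Fin (n + 1), C (r.coeff k) * X ^ (k : ℕ) := by
    intro r j hr
    rw [Fin.sum_univ_eq_sum_range (fun k => C (r.coeff k) * X ^ k)]
    exact r.as_sum_range_C_mul_X_pow' (by omega)
  have key : (Matrix.of fun i j : Fin (n + 1) => L (p i * q j))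
      = (Matrix.of fun i j : Fin (n + 1) => (p j).coeff i).transpose
        * (Matrix.of fun i j : Fin (n + 1) => L (X ^ (i.1 + j.1)))
        * (Matrix.of fun i j : Fin (n + 1) => (q j).coeff i) := by
    ext i j
    simp only [Matrix.mul_apply, Matrix.of_apply, Matrix.transpose_apply]
    conv_lhs => rw [expand (p i) i (hpd i), expand (q j) j (hqd j), Finset.sum_mul_sum]
    simp only [map_sum, Finset.sum_mul]
    rw [Finset.sum_comm]
    refine Finset.sum_congr rfl fun k _ => Finset.sum_congr rfl fun l _ => ?_
    rw [show C ((p i).coeff l) * X ^ (l : ℕ) * (C ((q j).coeff k) * X ^ (k : ℕ))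
      = ((p i).coeff l * (q j).coeff k) • (X ^ (l.1 + k.1) : R[X]) by
        rw [smul_eq_C_mul, C_mul]; ring, map_smul, smul_eq_mul]
    ring
  rw [key, Matrix.det_mul, Matrix.det_mul, Matrix.det_transpose,
    Matrix.det_matrixOfPolynomials (fun i : Fin (n + 1) => p i) (fun i => hpd i) (fun i => hp i),
    Matrix.det_matrixOfPolynomials (fun i : Fin (n + 1) => q i) (fun i => hqd i) (fun i => hq i)]
  simp [hankel]

/-- A checkerboard matrix of odd size has determinant zero. -/
theorem det_eq_zero_of_checkerboard (m : ℕ) (f : ℕ → ℕ → ℚ)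
    (hf : ∀ i j, Even (i + j) → f i j = 0) :
    (Matrix.of fun i j : Fin (2 * m + 1) => f i j).det = 0 := by
  set M := (Matrix.of fun i j : Fin (2 * m + 1) => f i j)
  set v : Fin (2 * m + 1) → ℚ := fun i => (-1) ^ i.1
  have h1 : (Matrix.of fun i j => v i * (Matrix.of fun i j => v j * M i j) i j) = -M := by
    ext i j
    simp only [Matrix.of_apply, Matrix.neg_apply, v, M]
    rcases Nat.even_or_odd (i.1 + j.1) with h | h
    · simp [hf _ _ h]
    · rw [← mul_assoc, ← pow_add, h.neg_one_pow, neg_one_mul]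
  have h2 := congrArg Matrix.det h1
  rw [Matrix.det_mul_column, Matrix.det_mul_row, Matrix.det_neg, Fintype.card_fin,
    ← mul_assoc, ← Finset.prod_mul_distrib] at h2
  have h3 : ∏ i, v i * v i = 1 := Finset.prod_eq_one fun i _ => by
    simp [v, ← mul_pow]
  rw [h3, (odd_two_mul_add_one m).neg_one_pow] at h2
  linarith

/-- The determinant of a matrix built from `2 × 2` antidiagonal blocks. -/
theorem det_antidiagonal_blocks (n : ℕ) (V : ℕ → ℕ → ℚ) :
    (Matrix.of fun i j : Fin (n * 2) =>
        if i.1 % 2 = j.1 % 2 then 0 else V (i.1 / 2) (j.1 / 2)).det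
      = (-1) ^ n * (Matrix.of fun i j : Fin n => V i j).det ^ 2 := by
  have h := Matrix.det_kronecker (Matrix.of fun i j : Fin n => V i j)
    (!![0, 1; 1, 0] : Matrix (Fin 2) (Fin 2) ℚ)
  rw [Matrix.det_fin_two_of, Fintype.card_fin, Fintype.card_fin,
    show (0 * 0 - 1 * 1 : ℚ) = -1 by norm_num] at h
  rw [← Matrix.det_submatrix_equiv_self (finProdFinEquiv (m := n) (n := 2))]
  rw [mul_comm ((-1 : ℚ) ^ n), ← h]
  congr 1
  ext ⟨i, a⟩ ⟨j, b⟩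
  have ha : (a.1 + 2 * i.1) / 2 = i.1 := by omega
  have hb : (b.1 + 2 * j.1) / 2 = j.1 := by omega
  simp only [Matrix.submatrix_apply, Matrix.of_apply, finProdFinEquiv_apply_val, ha, hb,
    Matrix.kroneckerMap_apply]
  fin_cases a <;> fin_cases b <;> simp

/-- Recursion for the determinant of the Hilbert matrix. -/
theorem det_hilbert_succ (n : ℕ) :
    (Matrix.of fun i j : Fin (n + 1) => (1 : ℚ) / (i.1 + j.1 + 1)).det
      = 1 / (2 * n + 1) * (∏ i ∈ range n, ((n : ℚ) - i) / (n + i + 1)) ^ 2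
        * (Matrix.of fun i j : Fin n => (1 : ℚ) / (i.1 + j.1 + 1)).det := by
  set H := (Matrix.of fun i j : Fin (n + 1) => (1 : ℚ) / (i.1 + j.1 + 1))
  have hpos : ∀ a b : ℕ, (a : ℚ) + b + 1 ≠ 0 := fun a b => by positivity
  have hblock : H.submatrix (finSumFinEquiv (m := n) (n := 1)) (finSumFinEquiv (m := n) (n := 1))
      = Matrix.fromBlocks (Matrix.of fun i j : Fin n => (1 : ℚ) / (i.1 + j.1 + 1))
        (Matrix.of fun (i : Fin n) (_ : Fin 1) => (1 : ℚ) / (i.1 + n + 1))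
        (Matrix.of fun (_ : Fin 1) (j : Fin n) => (1 : ℚ) / (n + j.1 + 1))
        (Matrix.diagonal fun _ => (1 : ℚ) / (n + n + 1)) := by
    ext (i | i) (j | j)
    · simp [H]
    · simp [H]
    · simp [H]
    · simp [H, Subsingleton.elim i j]
  let D : Invertible (Matrix.diagonal fun _ : Fin 1 => (1 : ℚ) / (n + n + 1)) :=
    ⟨Matrix.diagonal fun _ => ((n : ℚ) + n + 1),
      by simp [Matrix.diagonal_mul_diagonal, mul_inv_cancel₀ (hpos n n)],
      by simp [Matrix.diagonal_mul_diagonal, inv_mul_cancel₀ (hpos n n)]⟩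
  rw [← Matrix.det_submatrix_equiv_self (finSumFinEquiv (m := n) (n := 1)), hblock,
    Matrix.det_fromBlocks₂₂]
  have hD : ⅟(Matrix.diagonal fun _ : Fin 1 => (1 : ℚ) / (n + n + 1))
      = Matrix.diagonal fun _ => ((n : ℚ) + n + 1) := rfl
  rw [hD]
  set w : Fin n → ℚ := fun i => ((n : ℚ) - i.1) / (n + i.1 + 1)
  have hS : (Matrix.of fun i j : Fin n => (1 : ℚ) / (i.1 + j.1 + 1))
      - (Matrix.of fun (i : Fin n) (_ : Fin 1) => (1 : ℚ) / (i.1 + n + 1))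
        * (Matrix.diagonal fun _ : Fin 1 => ((n : ℚ) + n + 1))
        * (Matrix.of fun (_ : Fin 1) (j : Fin n) => (1 : ℚ) / (n + j.1 + 1))
      = Matrix.of fun i j => w i *
        (Matrix.of fun i j => w j * (Matrix.of fun i j : Fin n => (1 : ℚ) / (i.1 + j.1 + 1)) i j)
          i j := by
    ext i j
    simp only [Matrix.sub_apply, Matrix.mul_apply, Matrix.of_apply, Matrix.diagonal_apply_eq,
      Finset.univ_unique, Finset.sum_singleton, w]
    have h1 := hpos i j
    have h2 := hpos i n
    have h3 := hpos n j
    have h4 := hpos n i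
    field_simp
    ring
  rw [hS, Matrix.det_mul_column, Matrix.det_mul_row, Matrix.det_diagonal]
  have hw : ∏ i, w i = ∏ i ∈ range n, ((n : ℚ) - i) / (n + i + 1) :=
    Fin.prod_univ_eq_prod_range (fun i => ((n : ℚ) - i) / (n + i + 1)) n
  rw [hw]
  simp
  ring

theorem prod_range_sub_div_add (n : ℕ) :
    ∏ i ∈ range n, ((n : ℚ) - i) / (n + i + 1) = 1 / Nat.centralBinom n := by
  have h1 : ∏ i ∈ range n, ((n : ℚ) - i) = n.factorial := by
    rw [← Nat.descFactorial_self, Nat.descFactorial_eq_prod_range, Nat.cast_prod]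
    refine Finset.prod_congr rfl fun i hi => ?_
    rw [Nat.cast_sub (Finset.mem_range.1 hi).le]
  have h2 : ∏ i ∈ range n, ((n : ℚ) + i + 1) = (n + 1).ascFactorial n := by
    rw [Nat.ascFactorial_eq_prod_range, Nat.cast_prod]
    exact Finset.prod_congr rfl fun i _ => by push_cast; ring
  have h3 : (n + 1).ascFactorial n = n.factorial * Nat.centralBinom n := by
    rw [Nat.ascFactorial_eq_factorial_mul_choose, Nat.centralBinom, two_mul]
  rw [Finset.prod_div_distrib, h1, h2, h3]
  have := Nat.factorial_ne_zero n
  have := Nat.centralBinom_ne_zero n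
  push_cast
  field_simp

/-- The functional `p ↦ p'(1) + ⋯ + p'(s)`. -/
noncomputable def sumDeriv (s : ℕ) : ℚ[X] →ₗ[ℚ] ℚ :=
  ∑ j ∈ range s, (leval ((j : ℚ) + 1)).comp derivative

theorem sumDeriv_apply (s : ℕ) (p : ℚ[X]) :
    sumDeriv s p = ∑ j ∈ range s, (derivative p).eval ((j : ℚ) + 1) := by
  simp [sumDeriv]

theorem sumDeriv_X_pow (s : ℕ) : (fun k => sumDeriv s (X ^ k)) = powerSum s := by
  funext k
  have h := Finset.sum_Ico_add' (fun j : ℕ => (k : ℚ) * (j : ℚ) ^ (k - 1)) 0 s 1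
  rw [zero_add, Finset.Ico_add_one_right_eq_Icc, ← Finset.range_eq_Ico] at h
  rw [sumDeriv_apply, powerSum, Finset.mul_sum, ← h]
  simp [derivative_X_pow]

/-- Telescoping for the functional. -/
theorem sumDeriv_comp_sub (s : ℕ) (p : ℚ[X]) :
    sumDeriv s (p.comp (X + 1) - p)
      = (derivative (p.comp (X + 1))).eval (s : ℚ) - (derivative p).eval 1 := by
  rw [sumDeriv_apply]
  have h := Finset.sum_range_sub (fun j : ℕ => (derivative p).eval ((j : ℚ) + 1)) s
  simp only [Nat.cast_zero, zero_add] at h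
  simp only [derivative_sub, derivative_comp, derivative_add, derivative_X, derivative_one,
    add_zero, one_mul, eval_sub, eval_comp, eval_add, eval_X, eval_one]
  rw [← h]
  push_cast
  rfl

/-- Polynomials symmetric about `(s + 1) / 2` are annihilated. -/
theorem sumDeriv_eq_zero_of_symm (s : ℕ) (p : ℚ[X]) (hp : p.comp (C (s + 1 : ℚ) - X) = p) :
    sumDeriv s p = 0 := by
  have h : ∀ t : ℚ, (derivative p).eval (s + 1 - t) = -(derivative p).eval t := by
    intro t
    have := congrArg (fun q => (derivative q).eval t) hp
    simp [derivative_comp] at this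
    linarith
  have h1 : sumDeriv s p = -sumDeriv s p := by
    conv_lhs => rw [sumDeriv_apply, ← Finset.sum_range_reflect]
    rw [sumDeriv_apply, ← Finset.sum_neg_distrib]
    refine Finset.sum_congr rfl fun j hj => ?_
    rw [← h]
    congr 1
    have := Finset.mem_range.1 hj
    rw [Nat.sub_sub, Nat.cast_sub (by omega)]
    push_cast
    ring
  linarith

/-- The monic polynomial `∏_{k < i} ((X - h)² - (a + k)²)`. -/
noncomputable def quadProd (h a : ℚ) (i : ℕ) : ℚ[X] :=
  ∏ k ∈ range i, ((X - C h) ^ 2 - C ((a + k) ^ 2))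

theorem quadProd_succ (h a : ℚ) (i : ℕ) :
    quadProd h a (i + 1) = quadProd h a i * ((X - C h) ^ 2 - C ((a + i) ^ 2)) :=
  Finset.prod_range_succ _ _

theorem quadProd_factor_monic (h a : ℚ) :
    ((X - C h) ^ 2 - C a).Monic ∧ ((X - C h) ^ 2 - C a).natDegree = 2 := by
  have hm : ((X - C h) ^ 2).Monic := (monic_X_sub_C h).pow 2
  have hd : ((X - C h) ^ 2).natDegree = 2 := by simp
  refine ⟨hm.sub_of_left ?_, ?_⟩
  · rw [degree_eq_natDegree hm.ne_zero, hd]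
    exact degree_C_le.trans_lt (by norm_num)
  · rw [natDegree_sub_C, hd]

theorem quadProd_monic (h a : ℚ) (i : ℕ) : (quadProd h a i).Monic :=
  monic_prod_of_monic _ _ fun _ _ => (quadProd_factor_monic _ _).1

theorem natDegree_quadProd (h a : ℚ) (i : ℕ) : (quadProd h a i).natDegree = 2 * i := by
  rw [quadProd, natDegree_prod_of_monic _ _ fun _ _ => (quadProd_factor_monic _ _).1,
    Finset.sum_congr rfl fun _ _ => (quadProd_factor_monic _ _).2]
  simp [mul_comm]

/-- The monic sequence `q₀, (X - h) q₀, q₁, (X - h) q₁, …` with `qᵢ = quadProd h a i`. -/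
noncomputable def quadSeq (h a : ℚ) (k : ℕ) : ℚ[X] :=
  (X - C h) ^ (k % 2) * quadProd h a (k / 2)

theorem quadSeq_monic (h a : ℚ) (k : ℕ) : (quadSeq h a k).Monic :=
  ((monic_X_sub_C h).pow _).mul (quadProd_monic _ _ _)

theorem natDegree_quadSeq (h a : ℚ) (k : ℕ) : (quadSeq h a k).natDegree = k := by
  rw [quadSeq, ((monic_X_sub_C h).pow _).natDegree_mul (quadProd_monic _ _ _),
    natDegree_quadProd, (monic_X_sub_C h).natDegree_pow, natDegree_X_sub_C]
  omega

theorem quadProd_symm (s : ℕ) (a : ℚ) (i : ℕ) :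
    (quadProd ((s + 1) / 2) a i).comp (C (s + 1 : ℚ) - X) = quadProd ((s + 1) / 2) a i := by
  rw [quadProd, Polynomial.prod_comp]
  refine Finset.prod_congr rfl fun k _ => ?_
  simp only [sub_comp, pow_comp, X_comp, C_comp]
  have : C (s + 1 : ℚ) = C ((s + 1 : ℚ) / 2) + C ((s + 1 : ℚ) / 2) := by
    rw [← C_add]; congr 1; ring
  rw [this]
  ring

theorem sumDeriv_quadSeq_mul_of_eq (s : ℕ) (a b : ℚ) (i j : ℕ) (hij : i % 2 = j % 2) :
    sumDeriv s (quadSeq ((s + 1) / 2) a i * quadSeq ((s + 1) / 2) b j) = 0 := by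
  apply sumDeriv_eq_zero_of_symm
  rw [quadSeq, quadSeq, mul_comp, mul_comp, mul_comp, quadProd_symm, quadProd_symm, hij]
  simp only [pow_comp, sub_comp, X_comp, C_comp]
  have : C (s + 1 : ℚ) = C ((s + 1 : ℚ) / 2) + C ((s + 1 : ℚ) / 2) := by
    rw [← C_add]; congr 1; ring
  rw [this, show C ((s + 1 : ℚ) / 2) + C ((s + 1 : ℚ) / 2) - X - C ((s + 1 : ℚ) / 2)
    = -(X - C ((s + 1 : ℚ) / 2)) by ring, neg_pow]
  have h1 : ((-1 : ℚ[X]) ^ (j % 2)) * (-1) ^ (j % 2) = 1 := by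
    rw [← mul_pow]; simp
  linear_combination ((X - C ((s + 1 : ℚ) / 2)) ^ (j % 2)) ^ 2
    * quadProd ((s + 1) / 2) a (i / 2) * quadProd ((s + 1) / 2) b (j / 2) * h1

/-- The first family of weights in the Gram matrix. -/
noncomputable def leftWeight (s : ℕ) (i : ℕ) : ℚ :=
  s * ∏ k ∈ range i, (-((k + 1 + s) * (k + 1)) : ℚ)

/-- The second family of weights in the Gram matrix. -/
noncomputable def rightWeight (s : ℕ) (j : ℕ) : ℚ :=
  ∏ k ∈ range j, (-((k + 1 - s) * (k + 1)) : ℚ)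

theorem leftWeight_succ (s i : ℕ) :
    leftWeight s (i + 1) = leftWeight s i * -((i + 1 + s) * (i + 1)) := by
  rw [leftWeight, Finset.prod_range_succ, leftWeight, mul_assoc]

theorem rightWeight_succ (s j : ℕ) :
    rightWeight s (j + 1) = rightWeight s j * -((j + 1 - s) * (j + 1)) :=
  Finset.prod_range_succ _ _

theorem quadProd_succ_linear (s i : ℕ) :
    quadProd ((s + 1) / 2) ((s + 1) / 2) (i + 1)
      = quadProd ((s + 1) / 2) ((s + 1) / 2) i * ((X + C (i : ℚ)) * (X - C (s + 1 + i : ℚ))) := by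
  rw [quadProd_succ]
  congr 1
  refine Polynomial.funext fun t => ?_
  simp
  ring

theorem quadProd_shift (s i : ℕ) :
    X * (X - C (s + i : ℚ)) * (quadProd ((s + 1) / 2) ((s + 1) / 2) i).comp (X + 1)
      = (X + C (i : ℚ)) * (X - C (s : ℚ)) * quadProd ((s + 1) / 2) ((s + 1) / 2) i := by
  induction i with
  | zero => simp [quadProd]
  | succ i ih =>
    rw [quadProd_succ_linear]
    simp only [mul_comp, add_comp, sub_comp, X_comp, C_comp]
    simp only [Nat.cast_add, Nat.cast_one, C_add, C_1] at ih ⊢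
    linear_combination (X - (C (s : ℚ) + (C (i : ℚ) + 1))) * (X + 1 + C (i : ℚ)) * ih

theorem quadProd_eval_one (s i : ℕ) :
    (-(s + i) : ℚ) * (quadProd ((s + 1) / 2) ((s + 1) / 2) i).eval 1 = -leftWeight s i := by
  induction i with
  | zero => simp [quadProd, leftWeight]
  | succ i ih =>
    rw [quadProd_succ_linear, leftWeight_succ]
    simp only [eval_mul, eval_add, eval_sub, eval_X, eval_C]
    push_cast
    linear_combination (-(i + 1 + s) * (i + 1) : ℚ) * ih

theorem quadProd_eval_natCast (s i : ℕ) :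
    ((s + i) : ℚ) * (quadProd ((s + 1) / 2) ((s + 1) / 2) i).eval (s : ℚ) = leftWeight s i := by
  induction i with
  | zero => simp [quadProd, leftWeight]
  | succ i ih =>
    rw [quadProd_succ_linear, leftWeight_succ]
    simp only [eval_mul, eval_add, eval_sub, eval_X, eval_C]
    push_cast
    linear_combination (-(i + 1 + s) * (i + 1) : ℚ) * ih

theorem sumDeriv_mul_quadProd (s i : ℕ) :
    sumDeriv s ((X - C ((s + 1) / 2 : ℚ)) * quadProd ((s + 1) / 2) ((s + 1) / 2) i)
      = leftWeight s i / (i + 1) := by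
  set e := quadProd ((s + 1) / 2) ((s + 1) / 2) i
  set G : ℚ[X] := (X - 1) * ((X - C (s + 1 + i : ℚ)) * e)
  have hG : G.comp (X + 1) = (X - C (s : ℚ)) * ((X + C (i : ℚ)) * e) := by
    have := quadProd_shift s i
    simp only [G, mul_comp, sub_comp, X_comp, C_comp, one_comp]
    simp only [C_add, C_1] at this ⊢
    linear_combination this
  have hdiff : G.comp (X + 1) - G
      = (2 * (i + 1) : ℚ) • ((X - C ((s + 1) / 2 : ℚ)) * e) := by
    rw [hG, smul_eq_C_mul]
    refine Polynomial.funext fun t => ?_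
    simp [G]
    ring
  have hL := sumDeriv_comp_sub s G
  rw [hdiff, map_smul, smul_eq_mul, hG] at hL
  have h1 := quadProd_eval_one s i
  have h2 := quadProd_eval_natCast s i
  have d1 : (derivative G).eval 1 = (1 - (s + 1 + i) : ℚ) * e.eval 1 := by
    simp [G, derivative_mul]
  have d2 : (derivative ((X - C (s : ℚ)) * ((X + C (i : ℚ)) * e))).eval (s : ℚ)
      = (s + i : ℚ) * e.eval (s : ℚ) := by
    simp [derivative_mul]
  rw [d1, d2] at hL
  have : (i : ℚ) + 1 ≠ 0 := by positivity
  rw [eq_div_iff this]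
  linear_combination hL / 2 + h2 / 2 - h1 / 2

theorem sumDeriv_mul_quadProd_mul_quadProd (s i j : ℕ) :
    sumDeriv s ((X - C ((s + 1) / 2 : ℚ)) * (quadProd ((s + 1) / 2) ((s + 1) / 2) i
        * quadProd ((s + 1) / 2) ((1 - s) / 2) j))
      = leftWeight s i * rightWeight s j / (i + j + 1) := by
  induction j generalizing i with
  | zero => simpa [quadProd, rightWeight] using sumDeriv_mul_quadProd s i
  | succ j ih =>
    set x : ℚ[X] := X - C ((s + 1) / 2 : ℚ)
    have hrec : x * (quadProd ((s + 1) / 2) ((s + 1) / 2) i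
          * quadProd ((s + 1) / 2) ((1 - s) / 2) (j + 1))
        = x * (quadProd ((s + 1) / 2) ((s + 1) / 2) (i + 1)
          * quadProd ((s + 1) / 2) ((1 - s) / 2) j)
        + ((1 + i + j) * (s + i - j) : ℚ) • (x * (quadProd ((s + 1) / 2) ((s + 1) / 2) i
          * quadProd ((s + 1) / 2) ((1 - s) / 2) j)) := by
      rw [quadProd_succ, quadProd_succ, smul_eq_C_mul,
        show ((1 + i + j) * (s + i - j) : ℚ)
          = ((s + 1) / 2 + i) ^ 2 - ((1 - s) / 2 + j) ^ 2 by ring, C_sub]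
      ring
    rw [hrec, map_add, map_smul, ih, ih, leftWeight_succ, rightWeight_succ, smul_eq_mul]
    have h1 : (i : ℚ) + j + 1 ≠ 0 := by positivity
    have h2 : (i : ℚ) + 1 + j + 1 ≠ 0 := by positivity
    have h3 : (i : ℚ) + (j + 1) + 1 ≠ 0 := by positivity
    push_cast
    field_simp
    ring

theorem sumDeriv_quadSeq_mul (s i j : ℕ) :
    sumDeriv s (quadSeq ((s + 1) / 2) ((s + 1) / 2) i * quadSeq ((s + 1) / 2) ((1 - s) / 2) j)
      = if i % 2 = j % 2 then 0 else
        leftWeight s (i / 2) * rightWeight s (j / 2) / ((i / 2 : ℕ) + (j / 2 : ℕ) + 1) := by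
  split_ifs with h
  · exact sumDeriv_quadSeq_mul_of_eq s _ _ i j h
  · rw [← sumDeriv_mul_quadProd_mul_quadProd, quadSeq, quadSeq, mul_mul_mul_comm, ← pow_add,
      show i % 2 + j % 2 = 1 by omega, pow_one]

theorem hankel_powerSum_eq_det (s n : ℕ) :
    hankel (powerSum s) n = (Matrix.of fun i j : Fin (n + 1) =>
      if i.1 % 2 = j.1 % 2 then 0 else
        leftWeight s (i / 2) * rightWeight s (j / 2)
          / ((i / 2 : ℕ) + (j / 2 : ℕ) + 1 : ℚ)).det := by
  rw [← sumDeriv_X_pow, hankel_eq_det_of_monic (sumDeriv s) _ _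
    (quadSeq_monic ((s + 1) / 2) ((s + 1) / 2)) (quadSeq_monic ((s + 1) / 2) ((1 - s) / 2))
    (natDegree_quadSeq _ _) (natDegree_quadSeq _ _)]
  simp only [sumDeriv_quadSeq_mul]

/-- The coefficient `ℓ⁴(s² - ℓ²) / (4(2ℓ + 1)(2ℓ - 1))`. -/
noncomputable def recCoeff (s ℓ : ℕ) : ℚ :=
  (ℓ : ℚ) ^ 4 * ((s : ℚ) ^ 2 - (ℓ : ℚ) ^ 2) / (4 * (2 * (ℓ : ℚ) + 1) * (2 * (ℓ : ℚ) - 1))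

theorem weight_mul_eq_prod_recCoeff (s n : ℕ) :
    leftWeight s n * rightWeight s n
        * (1 / (2 * n + 1) * (∏ i ∈ range n, ((n : ℚ) - i) / (n + i + 1)) ^ 2)
      = s * ∏ ℓ ∈ Icc 1 n, -recCoeff s ℓ := by
  rw [prod_range_sub_div_add]
  induction n with
  | zero => simp [leftWeight, rightWeight]
  | succ n ih =>
    rw [Finset.prod_Icc_succ_top (by omega), ← mul_assoc (s : ℚ), ← ih, leftWeight_succ,
      rightWeight_succ, recCoeff]
    have hc : ((n : ℚ) + 1) * (Nat.centralBinom (n + 1) : ℚ)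
        = 2 * (2 * n + 1) * Nat.centralBinom n := by
      exact_mod_cast Nat.succ_mul_centralBinom_succ n
    have h0 : (Nat.centralBinom n : ℚ) ≠ 0 := by exact_mod_cast Nat.centralBinom_ne_zero n
    have h1 : (n : ℚ) + 1 ≠ 0 := by positivity
    have h2 : 2 * (n : ℚ) + 1 ≠ 0 := by positivity
    have h3 : 2 * ((n : ℚ) + 1) + 1 ≠ 0 := by positivity
    have h4 : 2 * ((n : ℚ) + 1) - 1 ≠ 0 := by
      rw [show 2 * ((n : ℚ) + 1) - 1 = 2 * n + 1 by ring]; exact h2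
    have hc' : (Nat.centralBinom (n + 1) : ℚ)
        = 2 * (2 * n + 1) * Nat.centralBinom n / (n + 1) := by
      rw [eq_div_iff h1]; linarith
    rw [hc']
    push_cast
    rw [show 2 * ((n : ℚ) + 1) - 1 = 2 * n + 1 by ring]
    field_simp
    ring

theorem det_weighted_hilbert_succ (s n : ℕ) :
    (Matrix.of fun i j : Fin (n + 1) =>
        leftWeight s i * rightWeight s j / ((i : ℕ) + (j : ℕ) + 1 : ℚ)).det
      = (s * ∏ ℓ ∈ Icc 1 n, -recCoeff s ℓ) * (Matrix.of fun i j : Fin n =>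
        leftWeight s i * rightWeight s j / ((i : ℕ) + (j : ℕ) + 1 : ℚ)).det := by
  have h : ∀ N : ℕ, (Matrix.of fun i j : Fin N =>
        leftWeight s i * rightWeight s j / ((i : ℕ) + (j : ℕ) + 1 : ℚ)).det
      = (∏ i ∈ range N, leftWeight s i) * ((∏ i ∈ range N, rightWeight s i)
        * (Matrix.of fun i j : Fin N => (1 : ℚ) / (i.1 + j.1 + 1)).det) := by
    intro N
    rw [← Fin.prod_univ_eq_prod_range, ← Fin.prod_univ_eq_prod_range, ← Matrix.det_mul_row,
      ← Matrix.det_mul_column]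
    congr 1
    ext i j
    simp only [Matrix.of_apply]
    ring
  rw [h, h, det_hilbert_succ, ← weight_mul_eq_prod_recCoeff, Finset.prod_range_succ,
    Finset.prod_range_succ]
  ring

theorem hankel_powerSum_odd (s m : ℕ) :
    hankel (powerSum s) (2 * m + 1)
      = (-1) ^ (m + 1) * (Matrix.of fun i j : Fin (m + 1) =>
        leftWeight s i * rightWeight s j / ((i : ℕ) + (j : ℕ) + 1 : ℚ)).det ^ 2 := by
  rw [hankel_powerSum_eq_det, ← det_antidiagonal_blocks (m + 1)
    (fun i j => leftWeight s i * rightWeight s j / ((i : ℕ) + (j : ℕ) + 1 : ℚ)),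
    ← Matrix.det_submatrix_equiv_self (finCongr (by ring : (m + 1) * 2 = 2 * m + 1 + 1))]
  rfl

theorem det_weighted_hilbert_sq (s m : ℕ) :
    (-1) ^ (m + 1) * (Matrix.of fun i j : Fin (m + 1) =>
        leftWeight s i * rightWeight s j / ((i : ℕ) + (j : ℕ) + 1 : ℚ)).det ^ 2
      = (-(s : ℚ) ^ 2) ^ (m + 1) * ∏ ℓ ∈ Icc 1 m, recCoeff s ℓ ^ (2 * (m + 1 - ℓ)) := by
  induction m with
  | zero => simp [leftWeight, rightWeight]
  | succ m ih =>
    have hprod : ∏ ℓ ∈ Icc 1 (m + 1), recCoeff s ℓ ^ (2 * (m + 1 + 1 - ℓ))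
        = (∏ ℓ ∈ Icc 1 m, recCoeff s ℓ ^ (2 * (m + 1 - ℓ)))
          * (∏ ℓ ∈ Icc 1 (m + 1), -recCoeff s ℓ) ^ 2 := by
      rw [Finset.prod_Icc_succ_top (by omega), Finset.prod_Icc_succ_top (by omega), mul_pow,
        ← mul_assoc, ← Finset.prod_pow, ← Finset.prod_mul_distrib]
      congr 1
      · refine Finset.prod_congr rfl fun ℓ hℓ => ?_
        have := (Finset.mem_Icc.1 hℓ).2
        rw [neg_sq, ← pow_add]
        congr 1
        omega
      · rw [neg_sq]; congr 1; omega
    rw [det_weighted_hilbert_succ, hprod, pow_succ (-(s : ℚ) ^ 2)]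
    linear_combination (-(s : ℚ) ^ 2 * (∏ ℓ ∈ Icc 1 (m + 1), -recCoeff s ℓ) ^ 2) * ih

theorem hankel_powerSum (s : ℕ) (hs : 1 ≤ s) (m : ℕ) :
    hankel (powerSum s) (2 * m) = 0 ∧
    hankel (powerSum s) (2 * m + 1)
      = (-(s : ℚ) ^ 2) ^ (m + 1) *
        ∏ ℓ ∈ Finset.Icc 1 m,
          ((ℓ : ℚ) ^ 4 * ((s : ℚ) ^ 2 - (ℓ : ℚ) ^ 2)
              / (4 * (2 * (ℓ : ℚ) + 1) * (2 * (ℓ : ℚ) - 1))) ^ (2 * (m + 1 - ℓ)) ∧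
    (s ≤ m → hankel (powerSum s) (2 * m + 1) = 0) := by
  have hodd := (hankel_powerSum_odd s m).trans (det_weighted_hilbert_sq s m)
  refine ⟨?_, hodd, fun hsm => ?_⟩
  · rw [hankel_powerSum_eq_det]
    refine det_eq_zero_of_checkerboard m (fun i j => if i % 2 = j % 2 then 0 else
      leftWeight s (i / 2) * rightWeight s (j / 2) / ((i / 2 : ℕ) + (j / 2 : ℕ) + 1 : ℚ))
      fun i j hij => if_pos ?_
    rw [Nat.even_iff] at hij
    omega
  · rw [hodd, Finset.prod_eq_zero (Finset.mem_Icc.2 ⟨hs, hsm⟩), mul_zero]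
    rw [recCoeff, sub_self, mul_zero, zero_div, zero_pow (by omega)]
end
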